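/- arXiv:1402.0639 — 4 statements merged into one kernel-verified Lean document; each statement's English description precedes it below -/
import Mathlib

section
/- Let ν > −1 and let a, b lie in the same component interval (α_{ν,2k}, α_{ν,2k+1}) of Δ_ν. Then the van der Corput type inequality |g_ν(a) − g_ν(b)| ≥ |a − b| √(g_ν'(a) g_ν'(b)) holds; equivalently, |a^{1−ν} J_ν(a) − b^{1−ν} J_ν(b)| ≥ |a − b| √((ab)^{−ν} d_ν(a) d_ν(b)). -/
open Real Filter Set

/-- The Bessel function of the first kind of order `ν`, defined by its power series. -/
noncomputable def besselJ (ν x : ℝ) : ℝ :=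
  ∑' n : ℕ, (-1 : ℝ) ^ n * x ^ (2 * (n : ℝ) + ν) /
    (2 ^ (2 * (n : ℝ) + ν) * (n.factorial : ℝ) * Real.Gamma ((n : ℝ) + ν + 1))

/-- The Dini function `d_ν(x) = (1-ν) J_ν(x) + x J_ν'(x) = J_ν(x) - x J_{ν+1}(x)`. -/
noncomputable def dini (ν x : ℝ) : ℝ :=
  besselJ ν x - x * besselJ (ν + 1) x

/-- The function `g_ν(x) = 2^ν Γ(ν+1) x^{1-ν} J_ν(x)`. -/
noncomputable def gfun (ν x : ℝ) : ℝ :=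
  2 ^ ν * Real.Gamma (ν + 1) * x ^ (1 - ν) * besselJ ν x

/-- Its derivative `g_ν'(x) = 2^ν Γ(ν+1) x^{-ν} d_ν(x)`. -/
noncomputable def gderiv (ν x : ℝ) : ℝ :=
  2 ^ ν * Real.Gamma (ν + 1) * x ^ (-ν) * dini ν x

/-- A nonzero real polynomial all of whose complex roots are negative real numbers. -/
def NegRooted (p : Polynomial ℝ) : Prop :=
  p.Splits ∧ p ≠ 0 ∧ ∀ r ∈ p.roots, r < 0

theorem exists_sum_mul_inv_sub_eq (z : ℂ) (s : Multiset ℝ) (hs : ∀ r ∈ s, r < 0) :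
    ∃ A B : ℝ, 0 ≤ A ∧ 0 ≤ B ∧
      z * ((s.map fun r : ℝ => 1 / (z - (r : ℂ))).sum) = A + B * z := by
  induction s using Multiset.induction_on with
  | empty => exact ⟨0, 0, le_rfl, le_rfl, by simp⟩
  | cons r s ih =>
    obtain ⟨A, B, hA, hB, h⟩ := ih fun r hr => hs r (Multiset.mem_cons_of_mem hr)
    have hr : r < 0 := hs r (Multiset.mem_cons_self r s)
    refine ⟨A + Complex.normSq z / Complex.normSq (z - r), B + -r / Complex.normSq (z - r),
      add_nonneg hA (div_nonneg (Complex.normSq_nonneg _) (Complex.normSq_nonneg _)),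
      add_nonneg hB (div_nonneg (by linarith) (Complex.normSq_nonneg _)), ?_⟩
    rw [Multiset.map_cons, Multiset.sum_cons, mul_add, h, one_div, Complex.inv_def]
    push_cast
    rw [Complex.normSq_eq_conj_mul_self (z := z), map_sub, Complex.conj_ofReal]
    ring

/-- The operator `X d/dX + a` with `a > 0` preserves negativity of the roots. -/
theorem NegRooted.exists_coeff_eq_add_mul {p : Polynomial ℝ} (hp : NegRooted p) {a : ℝ}
    (ha : 0 < a) :
    ∃ q, NegRooted q ∧ ∀ n, q.coeff n = ((n : ℝ) + a) * p.coeff n := by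
  obtain ⟨hsp, hp0, hneg⟩ := hp
  set q : Polynomial ℝ := Polynomial.X * p.derivative + Polynomial.C a * p with hq
  have key : ∀ z : ℂ, (q.map (algebraMap ℝ ℂ)).IsRoot z → ∃ r : ℝ, r < 0 ∧ (r : ℂ) = z := by
    intro z hz
    by_cases hpz : (p.map (algebraMap ℝ ℂ)).eval z = 0
    · obtain ⟨r, hr⟩ := hsp.mem_range_of_isRoot hp0 (i := algebraMap ℝ ℂ) hpz
      refine ⟨r, hneg r ?_, hr⟩
      rw [← hr, Polynomial.eval_map, Polynomial.eval₂_at_apply] at hpz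
      rw [Polynomial.mem_roots hp0]
      exact (algebraMap ℝ ℂ).injective (by simpa using hpz)
    · have h1 := (hsp.map (algebraMap ℝ ℂ)).eval_derivative_eq_eval_mul_sum hpz
      rw [hsp.roots_map, Multiset.map_map] at h1
      obtain ⟨A, B, hA, hB, h2⟩ := exists_sum_mul_inv_sub_eq z p.roots hneg
      have h3 : (p.map (algebraMap ℝ ℂ)).eval z * (A + B * z + a) = 0 := by
        have h4 : z * (p.map (algebraMap ℝ ℂ)).derivative.eval z
            + a * (p.map (algebraMap ℝ ℂ)).eval z = 0 := by
          simpa [hq, Polynomial.IsRoot, Polynomial.derivative_map] using hz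
        rw [h1] at h4
        rw [← h2, ← h4]
        simp only [Function.comp_def, Complex.coe_algebraMap]
        ring
      have h4 := (mul_eq_zero.1 h3).resolve_left hpz
      have hB0 : B ≠ 0 := by
        rintro rfl
        have : A + a = 0 := by
          have h5 : ((A + a : ℝ) : ℂ) = 0 := by
            rw [← h4]; push_cast; ring
          exact_mod_cast h5
        linarith
      refine ⟨-(A + a) / B, div_neg_of_neg_of_pos (by linarith) (hB.lt_of_ne' hB0), ?_⟩
      push_cast
      rw [div_eq_iff (by exact_mod_cast hB0)]
      linear_combination -h4
  have hq0 : q ≠ 0 := by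
    intro h
    have h1 : q.eval 0 = a * p.eval 0 := by simp [hq]
    rw [h, Polynomial.eval_zero] at h1
    have h2 : p.eval 0 = 0 := by
      rcases mul_eq_zero.1 h1.symm with h | h
      · exact absurd h ha.ne'
      · exact h
    exact lt_irrefl _ (hneg 0 ((Polynomial.mem_roots hp0).2 h2))
  refine ⟨q, ⟨?_, hq0, ?_⟩, ?_⟩
  · refine Polynomial.Splits.of_splits_map (algebraMap ℝ ℂ) (IsAlgClosed.splits _) fun z hz => ?_
    obtain ⟨r, -, h⟩ := key z (Polynomial.isRoot_of_mem_roots hz)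
    exact ⟨r, h⟩
  · intro r hr
    obtain ⟨r', h, h'⟩ := key r ((Polynomial.isRoot_of_mem_roots hr).map)
    rwa [Complex.ofReal_inj.1 h'] at h
  · intro n
    rcases n with _ | n
    · simp [hq]
    · simp [hq, Polynomial.coeff_X_mul, Polynomial.coeff_derivative]
      ring

theorem negRooted_one_add_X_pow (N : ℕ) : NegRooted ((1 + Polynomial.X : Polynomial ℝ) ^ N) := by
  have h : (1 + Polynomial.X : Polynomial ℝ) = Polynomial.X + Polynomial.C 1 := by
    rw [Polynomial.C_1, add_comm]
  refine ⟨?_, ?_, ?_⟩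
  · rw [h]; exact (Polynomial.Splits.X_add_C 1).pow N
  · rw [h]; exact pow_ne_zero _ (Polynomial.X_add_C_ne_zero 1)
  · intro r hr
    have h0 := Polynomial.isRoot_of_mem_roots hr
    have h1 : (1 + r) ^ N = 0 := by simpa [Polynomial.IsRoot] using h0
    have h2 : 1 + r = 0 := eq_zero_of_pow_eq_zero h1
    linarith

theorem exists_negRooted_coeff_eq_prod {c : ℝ} (hc : 0 < c) (N k : ℕ) :
    ∃ p, NegRooted p ∧ ∀ n, p.coeff n =
      (∏ j ∈ Finset.range k, ((n : ℝ) + (c + j))) * (N.choose n : ℝ) := by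
  induction k with
  | zero => exact ⟨_, negRooted_one_add_X_pow N, fun n => by
      simp [Polynomial.coeff_one_add_X_pow]⟩
  | succ k ih =>
    obtain ⟨p, hp, h⟩ := ih
    obtain ⟨q, hq, h'⟩ := hp.exists_coeff_eq_add_mul (a := c + k) (by positivity)
    exact ⟨q, hq, fun n => by rw [h', h, Finset.prod_range_succ]; ring⟩

theorem NegRooted.eval_mul_eval_le {p : Polynomial ℝ} (hp : NegRooted p) {a b x : ℝ}
    (ha : 0 ≤ a) (hx : x ∈ Icc a b) (h0 : ∀ y ∈ Icc a b, p.eval (-y ^ 2) ≠ 0) :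
    p.eval (-a ^ 2) * p.eval (-b ^ 2) ≤ p.eval (-x ^ 2) * p.eval (-(a + b - x) ^ 2) := by
  obtain ⟨hsp, hp0, hneg⟩ := hp
  have hprod : ∀ y z : ℝ, p.eval (-y ^ 2) * p.eval (-z ^ 2) = p.leadingCoeff ^ 2 *
      (p.roots.map fun r => (-y ^ 2 - r) * (-z ^ 2 - r)).prod := by
    intro y z
    rw [hsp.eval_eq_prod_roots, hsp.eval_eq_prod_roots, Multiset.prod_map_mul]
    ring
  rw [hprod, hprod]
  refine mul_le_mul_of_nonneg_left ?_ (sq_nonneg _)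
  have hr : ∀ r ∈ p.roots, 0 ≤ (-a ^ 2 - r) * (-b ^ 2 - r) ∧
      (-a ^ 2 - r) * (-b ^ 2 - r) ≤ (-x ^ 2 - r) * (-(a + b - x) ^ 2 - r) := by
    intro r hr
    obtain ⟨ρ, hρ, rfl⟩ : ∃ ρ : ℝ, 0 ≤ ρ ∧ r = -ρ ^ 2 :=
      ⟨√(-r), Real.sqrt_nonneg _, by rw [Real.sq_sqrt (by linarith [hneg r hr])]; ring⟩
    have hρab : ρ ∉ Icc a b := fun h => h0 ρ h (Polynomial.isRoot_of_mem_roots hr)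
    have hd : 0 ≤ (x - a) * (b - x) := mul_nonneg (by linarith [hx.1]) (by linarith [hx.2])
    have h1 : 0 ≤ (a - ρ) * (b - ρ) := by
      have hab := hx.1.trans hx.2
      rcases lt_or_ge ρ a with h | h
      · exact mul_nonneg (by linarith) (by linarith)
      · have : b < ρ := by
          by_contra! h'
          exact hρab ⟨h, h'⟩
        exact mul_nonneg_of_nonpos_of_nonpos (by linarith) (by linarith)
    have h2 : 0 ≤ (a + ρ) * (b + ρ) :=
      mul_nonneg (by linarith) (by linarith [hx.1.trans hx.2])
    have h3 : (a - ρ) * (b - ρ) ≤ (x - ρ) * (a + b - x - ρ) := by linarith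
    have h4 : (a + ρ) * (b + ρ) ≤ (x + ρ) * (a + b - x + ρ) := by linarith
    have h5 := mul_le_mul h3 h4 h2 (h1.trans h3)
    constructor
    · linarith [mul_nonneg h1 h2]
    · linarith
  exact Multiset.prod_map_le_prod_map₀ _ _ (fun r h => (hr r h).1) fun r h => (hr r h).2

/-- The coefficients `1 / (n! (c)_n)` of the hypergeometric function `₀F₁(; c; ·)`. -/
noncomputable def hypCoeff (c : ℝ) (n : ℕ) : ℝ :=
  1 / ((n.factorial : ℝ) * ∏ j ∈ Finset.range n, (c + j))

theorem hypCoeff_pos {c : ℝ} (hc : 0 < c) (n : ℕ) : 0 < hypCoeff c n :=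
  one_div_pos.2 (mul_pos (by positivity) (Finset.prod_pos fun j _ => by positivity))

theorem hypCoeff_succ {c : ℝ} (hc : 0 < c) (n : ℕ) :
    hypCoeff c (n + 1) = hypCoeff c n / ((n + 1) * (c + n)) := by
  have h : (∏ j ∈ Finset.range n, (c + j)) ≠ 0 :=
    (Finset.prod_pos fun j _ => by positivity).ne'
  have h' : c + n ≠ 0 := by positivity
  have h'' : (n.factorial : ℝ) ≠ 0 := by positivity
  rw [hypCoeff, hypCoeff, Finset.prod_range_succ, Nat.factorial_succ]
  push_cast
  field_simp

theorem hypCoeff_le {c : ℝ} (hc : 0 < c) (n : ℕ) :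
    hypCoeff c n ≤ (1 + 1 / c) / n.factorial := by
  have hp : ∀ n : ℕ, c ≤ ∏ j ∈ Finset.range (n + 1), (c + j) := by
    intro n
    induction n with
    | zero => simp
    | succ n ih =>
      rw [Finset.prod_range_succ]
      refine ih.trans (le_mul_of_one_le_right (hc.le.trans ih) ?_)
      push_cast
      linarith [n.cast_nonneg (α := ℝ)]
  have hf : (0 : ℝ) < n.factorial := by positivity
  rw [hypCoeff, mul_comm, ← div_div]
  refine div_le_div_of_nonneg_right ?_ hf.le
  rcases n with _ | n
  · simpa using hc.le
  · have := one_div_le_one_div_of_le hc (hp n)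
    linarith

theorem summable_hypCoeff {c : ℝ} (hc : 0 < c) {R : ℝ} (hR : 0 ≤ R) :
    Summable fun n : ℕ => (2 * n + 1 : ℝ) * hypCoeff c n * R ^ n := by
  refine Summable.of_nonneg_of_le (fun n => ?_) (fun n => ?_)
    ((Real.summable_pow_div_factorial (3 * R)).mul_left (1 + 1 / c))
  · have := (hypCoeff_pos hc n).le
    positivity
  · have h3 : (2 * n + 1 : ℝ) ≤ 3 ^ n := by
      have := one_add_mul_le_pow (a := (2 : ℝ)) (by norm_num) n
      norm_num at this
      linarith
    calc (2 * n + 1 : ℝ) * hypCoeff c n * R ^ n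
        ≤ 3 ^ n * ((1 + 1 / c) / n.factorial) * R ^ n := by
          gcongr
          · exact (hypCoeff_pos hc n).le
          · exact hypCoeff_le hc n
      _ = (1 + 1 / c) * ((3 * R) ^ n / n.factorial) := by rw [mul_pow]; ring

/-- The entire function whose value at `(x / 2) ^ 2` is `gderiv (c - 1) x`. -/
noncomputable def diniSeries (c t : ℝ) : ℝ :=
  ∑' n : ℕ, (2 * n + 1 : ℝ) * hypCoeff c n * (-t) ^ n

theorem summable_diniSeries {c : ℝ} (hc : 0 < c) (t : ℝ) :
    Summable fun n : ℕ => (2 * n + 1 : ℝ) * hypCoeff c n * (-t) ^ n := by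
  refine Summable.of_norm_bounded (summable_hypCoeff hc (abs_nonneg t)) fun n => ?_
  have := (hypCoeff_pos hc n).le
  rw [norm_mul, norm_pow, norm_neg, Real.norm_eq_abs t,
    Real.norm_of_nonneg (by positivity)]

theorem continuous_diniSeries {c : ℝ} (hc : 0 < c) : Continuous (diniSeries c) := by
  rw [continuous_iff_continuousAt]
  intro t
  have h : ContinuousOn (diniSeries c) (Metric.ball 0 (|t| + 1)) := by
    refine continuousOn_tsum (fun n => by fun_prop)
      (summable_hypCoeff hc (by positivity : 0 ≤ |t| + 1)) fun n x hx => ?_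
    have := (hypCoeff_pos hc n).le
    rw [norm_mul, norm_pow, norm_neg, Real.norm_of_nonneg (by positivity)]
    gcongr
    exact (mem_ball_zero_iff.1 hx).le
  exact h.continuousAt (Metric.isOpen_ball.mem_nhds (by simp))

/-- The ratio of the coefficients of the polynomial approximants to their limits. -/
noncomputable def approxRatio (c : ℝ) (M n : ℕ) : ℝ :=
  ∏ i ∈ Finset.range n, (1 - i / M) * (1 + (c + i) / M)

theorem tendsto_approxRatio (c : ℝ) (n : ℕ) :
    Tendsto (fun M => approxRatio c M n) atTop (nhds 1) := by
  have h : Tendsto (fun M : ℕ => approxRatio c M n) atTop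
      (nhds (∏ i ∈ Finset.range n, (1 - 0) * (1 + 0))) := by
    refine tendsto_finsetProd _ fun i _ => ?_
    exact (tendsto_const_nhds.sub (tendsto_const_div_atTop_nhds_zero_nat _)).mul
      (tendsto_const_nhds.add (tendsto_const_div_atTop_nhds_zero_nat _))
  simpa using h

theorem abs_approxRatio_le {c : ℝ} (hc : 0 < c) {M : ℕ} (hM : 0 < M) (n : ℕ) :
    |approxRatio c M n| ≤ (2 + c) ^ n := by
  have hM' : (1 : ℝ) ≤ M := by exact_mod_cast hM
  rcases le_or_gt n M with h | h
  · rw [approxRatio, Finset.abs_prod]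
    refine (Finset.prod_le_prod (fun _ _ => abs_nonneg _) (g := fun _ => 2 + c)
      fun i hi => ?_).trans_eq (by simp)
    have hi' : (i : ℝ) ≤ M := by
      exact_mod_cast (Finset.mem_range.1 hi).le.trans h
    have h1 : (i : ℝ) / M ≤ 1 := (div_le_one (by linarith)).2 hi'
    have h2 : c / M ≤ c := div_le_self hc.le hM'
    have h3 : 0 ≤ (i : ℝ) / M := by positivity
    have h4 : 0 ≤ c / M := by positivity
    rw [add_div, abs_of_nonneg (mul_nonneg (by linarith) (by linarith))]
    nlinarith
  · rw [approxRatio, Finset.prod_eq_zero (Finset.mem_range.2 h), abs_zero]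
    · positivity
    · rw [div_self (by positivity)]
      simp

theorem prod_mul_choose_eq {c : ℝ} (hc : 0 < c) {M : ℕ} (hM : 0 < M) (n : ℕ) :
    (∏ j ∈ Finset.range M, ((n : ℝ) + (c + j))) * (M.choose n : ℝ) =
      (∏ j ∈ Finset.range M, (c + j)) * (hypCoeff c n * approxRatio c M n * (M ^ 2 : ℝ) ^ n) := by
  have hM' : (M : ℝ) ≠ 0 := by positivity
  induction n with
  | zero => simp [hypCoeff, approxRatio]
  | succ n ih =>
    have hch : (M.choose (n + 1) : ℝ) * (n + 1) = M.choose n * (M - n) := by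
      rcases le_or_gt n M with h | h
      · rw [← Nat.cast_sub h]
        exact_mod_cast Nat.choose_succ_right_eq M n
      · rw [Nat.choose_eq_zero_of_lt h, Nat.choose_eq_zero_of_lt (by omega)]
        simp
    have hpr : (∏ j ∈ Finset.range M, (((n + 1 : ℕ) : ℝ) + (c + j))) * (c + n) =
        (∏ j ∈ Finset.range M, ((n : ℝ) + (c + j))) * (c + n + M) := by
      have h1 := Finset.prod_range_succ (fun j : ℕ => (n : ℝ) + (c + j)) M
      have h2 := Finset.prod_range_succ' (fun j : ℕ => (n : ℝ) + (c + j)) M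
      rw [h1] at h2
      have h3 : ∀ j : ℕ, (((n + 1 : ℕ) : ℝ) + (c + j)) = (n : ℝ) + (c + (j + 1 : ℕ)) := by
        intro j; push_cast; ring
      simp_rw [h3]
      simp only [Nat.cast_zero] at h2
      linear_combination -h2
    have hcn : c + n ≠ 0 := by positivity
    have hn1 : (n + 1 : ℝ) ≠ 0 := by positivity
    rw [← mul_left_inj' hcn, ← mul_left_inj' hn1]
    rw [hypCoeff_succ hc, approxRatio, Finset.prod_range_succ, ← approxRatio, pow_succ]
    have hL : (∏ j ∈ Finset.range M, (((n + 1 : ℕ) : ℝ) + (c + j))) * (M.choose (n + 1) : ℝ)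
        * (c + n) * (n + 1) =
        ((∏ j ∈ Finset.range M, ((n : ℝ) + (c + j))) * (M.choose n : ℝ)) *
          ((c + n + M) * (M - n)) := by
      linear_combination (M.choose (n + 1) * (n + 1) : ℝ) * hpr +
        (∏ j ∈ Finset.range M, ((n : ℝ) + (c + j))) * (c + n + M) * hch
    rw [hL, ih]
    field_simp
    ring

/-- The polynomial approximants of `diniSeries c`, as series. -/
noncomputable def diniApprox (c : ℝ) (M : ℕ) (t : ℝ) : ℝ :=
  ∑' n : ℕ, (2 * n + 1 : ℝ) * (hypCoeff c n * approxRatio c M n) * (-t) ^ n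

theorem abs_approxTerm_le {c : ℝ} (hc : 0 < c) {M : ℕ} (hM : 0 < M) {R t : ℝ} (ht : |t| ≤ R)
    (n : ℕ) : ‖(2 * n + 1 : ℝ) * (hypCoeff c n * approxRatio c M n) * (-t) ^ n‖ ≤
      (2 * n + 1 : ℝ) * hypCoeff c n * ((2 + c) * R) ^ n := by
  have h := (hypCoeff_pos hc n).le
  rw [norm_mul, norm_mul, norm_mul, norm_pow, norm_neg, Real.norm_of_nonneg h,
    Real.norm_of_nonneg (by positivity : (0 : ℝ) ≤ 2 * n + 1), Real.norm_eq_abs t,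
    Real.norm_eq_abs, mul_pow, ← mul_assoc, ← mul_assoc]
  gcongr
  exact abs_approxRatio_le hc hM n

theorem diniApprox_tendstoUniformlyOn {c : ℝ} (hc : 0 < c) {R : ℝ} (hR : 0 ≤ R) :
    TendstoUniformlyOn (diniApprox c) (diniSeries c) atTop (Icc (-R) R) := by
  have hlim : Tendsto (fun M => ∑' n : ℕ, (2 * n + 1 : ℝ) * hypCoeff c n *
      |approxRatio c M n - 1| * R ^ n) atTop (nhds (∑' n : ℕ, (0 : ℝ))) := by
    refine tendsto_tsum_of_dominated_convergence
      (summable_hypCoeff hc (by positivity : 0 ≤ (3 + c) * R)) (fun n => ?_) ?_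
    · have h := (((tendsto_approxRatio c n).sub_const 1).abs.const_mul
        ((2 * n + 1 : ℝ) * hypCoeff c n)).mul_const (R ^ n)
      simpa using h
    · filter_upwards [eventually_gt_atTop 0] with M hM n
      have h := (hypCoeff_pos hc n).le
      have h1 := abs_approxRatio_le hc hM n
      have h2 : |approxRatio c M n - 1| ≤ (3 + c) ^ n := by
        rcases n with _ | n
        · simp [approxRatio]
        · have h3 : (2 + c) ^ (n + 1) + 1 ^ (n + 1) ≤ (2 + c + 1) ^ (n + 1) :=
            pow_add_pow_le (by positivity) zero_le_one (by omega)
          have h4 := abs_sub (approxRatio c M (n + 1)) 1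
          rw [abs_one] at h4
          rw [one_pow] at h3
          calc _ ≤ _ := h4
            _ ≤ (2 + c + 1) ^ (n + 1) := by linarith
            _ = _ := by ring
      rw [Real.norm_of_nonneg (by positivity), mul_pow, ← mul_assoc]
      gcongr
  rw [tsum_zero] at hlim
  rw [Metric.tendstoUniformlyOn_iff]
  intro ε hε
  filter_upwards [hlim.eventually_lt_const hε, eventually_gt_atTop 0] with M hMε hM t ht
  have ht' : |t| ≤ R := abs_le.2 ht
  refine lt_of_le_of_lt ?_ hMε
  have hs1 := Summable.of_norm_bounded
    (summable_hypCoeff hc (by positivity : 0 ≤ (2 + c) * R)) (abs_approxTerm_le hc hM ht')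
  have hnorm : ∀ (x : ℝ) (n : ℕ), ‖(2 * n + 1 : ℝ) * (hypCoeff c n * approxRatio c M n) * (-x) ^ n -
      (2 * n + 1 : ℝ) * hypCoeff c n * (-x) ^ n‖ =
      (2 * n + 1 : ℝ) * hypCoeff c n * |approxRatio c M n - 1| * |x| ^ n := by
    intro x n
    have h := (hypCoeff_pos hc n).le
    have h1 : (2 * n + 1 : ℝ) * (hypCoeff c n * approxRatio c M n) * (-x) ^ n -
        (2 * n + 1 : ℝ) * hypCoeff c n * (-x) ^ n =
        (2 * n + 1 : ℝ) * hypCoeff c n * (approxRatio c M n - 1) * (-x) ^ n := by ring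
    rw [h1, norm_mul, norm_mul, norm_pow, norm_neg, Real.norm_of_nonneg (by positivity),
      Real.norm_eq_abs, Real.norm_eq_abs]
  rw [dist_comm, dist_eq_norm, diniApprox, diniSeries,
    ← Summable.tsum_sub hs1 (summable_diniSeries hc t)]
  refine tsum_of_norm_bounded (Summable.hasSum ?_) fun n => ?_
  · have hs2 := (Summable.of_norm_bounded (summable_hypCoeff hc (by positivity : 0 ≤ (2 + c) * R))
      (abs_approxTerm_le hc hM (abs_of_nonneg hR).le)).sub (summable_diniSeries hc R)
    exact hs2.norm.congr fun n => by rw [hnorm, abs_of_nonneg hR]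
  · have h := (hypCoeff_pos hc n).le
    rw [hnorm]
    gcongr

theorem exists_negRooted_eval_eq {c : ℝ} (hc : 0 < c) {M : ℕ} (hM : 0 < M) :
    ∃ p, NegRooted p ∧ ∃ C : ℝ, 0 < C ∧
      ∀ t, p.eval (-t / (M : ℝ) ^ 2) = C * diniApprox c M t := by
  obtain ⟨p, hp, h⟩ := exists_negRooted_coeff_eq_prod hc M M
  obtain ⟨q, hq, h'⟩ := hp.exists_coeff_eq_add_mul (a := 1 / 2) (by norm_num)
  refine ⟨q, hq, (∏ j ∈ Finset.range M, (c + j)) / 2,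
    half_pos (Finset.prod_pos fun j _ => by positivity), fun t => ?_⟩
  have hcoeff : ∀ n, q.coeff n = (∏ j ∈ Finset.range M, (c + j)) / 2 *
      ((2 * n + 1 : ℝ) * (hypCoeff c n * approxRatio c M n)) * (M ^ 2 : ℝ) ^ n := by
    intro n
    rw [h', h, prod_mul_choose_eq hc hM]
    ring
  have hM' : (M : ℝ) ≠ 0 := by positivity
  have hterm : ∀ n, q.coeff n * (-t / (M : ℝ) ^ 2) ^ n = (∏ j ∈ Finset.range M, (c + j)) / 2 *
      ((2 * n + 1 : ℝ) * (hypCoeff c n * approxRatio c M n) * (-t) ^ n) := by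
    intro n
    rw [hcoeff, div_pow]
    field_simp
  rw [diniApprox, ← tsum_mul_left, Polynomial.eval_eq_sum_range]
  simp_rw [← hterm]
  refine (tsum_eq_sum fun n hn => ?_).symm
  rw [Polynomial.coeff_eq_zero_of_natDegree_lt (by simpa using hn), zero_mul]

theorem diniSeries_mul_le {c : ℝ} (hc : 0 < c) {a b x : ℝ} (ha : 0 ≤ a) (hx : x ∈ Icc a b)
    (h0 : ∀ y ∈ Icc a b, diniSeries c (y ^ 2) ≠ 0) :
    diniSeries c (a ^ 2) * diniSeries c (b ^ 2) ≤
      diniSeries c (x ^ 2) * diniSeries c ((a + b - x) ^ 2) := by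
  have hab : a ≤ b := hx.1.trans hx.2
  have hcont : Continuous fun y => |diniSeries c (y ^ 2)| :=
    ((continuous_diniSeries hc).comp (continuous_pow 2)).abs
  obtain ⟨y₀, hy₀, hmin⟩ := isCompact_Icc.exists_isMinOn ⟨x, hx⟩ hcont.continuousOn
  have hmem : ∀ y ∈ Icc a b, y ^ 2 ∈ Icc (-b ^ 2) (b ^ 2) := fun y hy =>
    ⟨by nlinarith [sq_nonneg y, sq_nonneg b], pow_le_pow_left₀ (ha.trans hy.1) hy.2 2⟩
  have hu := diniApprox_tendstoUniformlyOn hc (sq_nonneg b)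
  have hlim : ∀ y ∈ Icc a b, Tendsto (fun M => diniApprox c M (y ^ 2)) atTop
      (nhds (diniSeries c (y ^ 2))) := fun y hy => hu.tendsto_at (hmem y hy)
  have hx' : a + b - x ∈ Icc a b := ⟨by linarith [hx.2], by linarith [hx.1]⟩
  refine le_of_tendsto_of_tendsto ((hlim a ⟨le_rfl, hab⟩).mul (hlim b ⟨hab, le_rfl⟩))
    ((hlim x hx).mul (hlim _ hx')) ?_
  filter_upwards [Metric.tendstoUniformlyOn_iff.1 hu _ (abs_pos.2 (h0 y₀ hy₀)),
    eventually_gt_atTop 0] with M hM hM0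
  obtain ⟨p, hp, C, hC, hpC⟩ := exists_negRooted_eval_eq hc hM0
  have hM1 : (0 : ℝ) < M := by exact_mod_cast hM0
  have hev : ∀ y : ℝ, p.eval (-(y / M) ^ 2) = C * diniApprox c M (y ^ 2) := by
    intro y
    rw [← hpC, div_pow, neg_div]
  have hne : ∀ z ∈ Icc (a / M) (b / M), p.eval (-z ^ 2) ≠ 0 := by
    intro z hz
    have hzM : z * M ∈ Icc a b := ⟨(div_le_iff₀ hM1).1 hz.1, (le_div_iff₀ hM1).1 hz.2⟩
    have h1 := hev (z * M)
    rw [mul_div_cancel_right₀ _ hM1.ne'] at h1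
    rw [h1]
    refine mul_ne_zero hC.ne' fun h2 => ?_
    have h3 := hM _ (hmem _ hzM)
    rw [h2, dist_zero_right, Real.norm_eq_abs] at h3
    exact absurd (hmin hzM) (not_le.2 h3)
  have hxM : x / M ∈ Icc (a / M) (b / M) :=
    ⟨div_le_div_of_nonneg_right hx.1 hM1.le, div_le_div_of_nonneg_right hx.2 hM1.le⟩
  have h := hp.eval_mul_eval_le (div_nonneg ha hM1.le) hxM hne
  rw [← add_div, ← sub_div, hev, hev, hev, hev] at h
  have hCC : 0 < C * C := mul_pos hC hC
  nlinarith [h, hCC]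

theorem sub_mul_sqrt_le_abs_integral {f : ℝ → ℝ} {a b : ℝ} (hab : a ≤ b) (hf : Continuous f)
    (h0 : ∀ y ∈ Icc a b, f y ≠ 0)
    (hmul : ∀ x ∈ Icc a b, f a * f b ≤ f x * f (a + b - x)) :
    (b - a) * √(f a * f b) ≤ |∫ x in a..b, f x| := by
  have hpos : ∀ g : ℝ → ℝ, Continuous g → (∀ y ∈ Icc a b, 0 ≤ g y) →
      (∀ x ∈ Icc a b, g a * g b ≤ g x * g (a + b - x)) →
      (b - a) * √(g a * g b) ≤ ∫ x in a..b, g x := by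
    intro g hg h1 h2
    have hrefl : ∫ x in a..b, g (a + b - x) = ∫ x in a..b, g x := by
      rw [intervalIntegral.integral_comp_sub_left (fun x => g x) (a + b)]
      simp
    have hg' : Continuous fun x => g (a + b - x) := by fun_prop
    have h3 : ∫ _ in a..b, 2 * √(g a * g b) ≤ ∫ x in a..b, (g x + g (a + b - x)) := by
      refine intervalIntegral.integral_mono_on hab intervalIntegrable_const
        ((hg.add hg').intervalIntegrable _ _) fun x hx => ?_
      have hx' : a + b - x ∈ Icc a b := ⟨by linarith [hx.2], by linarith [hx.1]⟩
      have h4 := h1 x hx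
      have h5 := h1 _ hx'
      have h6 : √(g a * g b) ≤ (g x + g (a + b - x)) / 2 := by
        rw [Real.sqrt_le_left (by positivity)]
        nlinarith [h2 x hx, sq_nonneg (g x - g (a + b - x))]
      linarith
    rw [intervalIntegral.integral_add (hg.intervalIntegrable _ _) (hg'.intervalIntegrable _ _),
      hrefl, intervalIntegral.integral_const, smul_eq_mul] at h3
    linarith
  have hsign : (∀ y ∈ Icc a b, 0 ≤ f y) ∨ ∀ y ∈ Icc a b, f y ≤ 0 := by
    by_contra! h
    obtain ⟨⟨y, hy, hy'⟩, z, hz, hz'⟩ := h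
    obtain ⟨w, hw, hw0⟩ := isPreconnected_Icc.intermediate_value hy hz hf.continuousOn
      ⟨hy'.le, hz'.le⟩
    exact h0 w hw hw0
  rcases hsign with h | h
  · exact (hpos f hf h hmul).trans (le_abs_self _)
  · have h1 := hpos (fun x => -f x) hf.neg (fun y hy => neg_nonneg.2 (h y hy))
      fun x hx => by simpa using hmul x hx
    rw [intervalIntegral.integral_neg] at h1
    simp only [neg_mul_neg] at h1
    exact h1.trans (neg_le_abs _)

theorem Gamma_add_natCast {c : ℝ} (hc : 0 < c) (n : ℕ) :
    Real.Gamma (n + c) = (∏ j ∈ Finset.range n, (c + j)) * Real.Gamma c := by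
  induction n with
  | zero => simp
  | succ n ih =>
    rw [Finset.prod_range_succ, mul_right_comm, ← ih, mul_comm, add_comm c (n : ℝ),
      ← Real.Gamma_add_one (by positivity)]
    push_cast
    ring_nf

theorem two_rpow_mul_rpow_mul_besselJ {ν : ℝ} (hν : -1 < ν) {x : ℝ} (hx : 0 < x) :
    2 ^ ν * Real.Gamma (ν + 1) * x ^ (-ν) * besselJ ν x =
      ∑' n : ℕ, hypCoeff (ν + 1) n * (-(x / 2) ^ 2) ^ n := by
  have hc : 0 < ν + 1 := by linarith
  rw [besselJ, ← tsum_mul_left]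
  refine tsum_congr fun n => ?_
  have hG := Real.Gamma_pos_of_pos hc
  have hP : 0 < ∏ j ∈ Finset.range n, (ν + 1 + j) := Finset.prod_pos fun j _ => by positivity
  have h2 : (2 : ℝ) ^ (2 * (n : ℝ) + ν) = 2 ^ (2 * n) * 2 ^ ν := by
    rw [Real.rpow_add two_pos]; norm_cast
  have h3 : x ^ (2 * (n : ℝ) + ν) = x ^ (2 * n) * x ^ ν := by
    rw [Real.rpow_add hx]; norm_cast
  have h4 := Real.rpow_pos_of_pos hx ν
  have h5 := Real.rpow_pos_of_pos two_pos ν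
  rw [h2, h3, add_assoc (n : ℝ), Gamma_add_natCast hc, hypCoeff, Real.rpow_neg hx.le,
    neg_pow ((x / 2) ^ 2),
    div_pow, div_pow, ← pow_mul, ← pow_mul]
  field_simp

theorem summable_besselSeries {c : ℝ} (hc : 0 < c) (t : ℝ) :
    Summable fun n : ℕ => hypCoeff c n * (-t) ^ n := by
  refine Summable.of_norm_bounded (summable_hypCoeff hc (abs_nonneg t)) fun n => ?_
  have := (hypCoeff_pos hc n).le
  rw [norm_mul, norm_pow, norm_neg, Real.norm_eq_abs t, Real.norm_of_nonneg this]
  gcongr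
  exact le_mul_of_one_le_left this (by linarith [n.cast_nonneg (α := ℝ)])

theorem gfun_eq {ν : ℝ} (hν : -1 < ν) {x : ℝ} (hx : 0 < x) :
    gfun ν x = ∑' n : ℕ, hypCoeff (ν + 1) n * (-(x / 2) ^ 2) ^ n * x := by
  rw [tsum_mul_right, ← two_rpow_mul_rpow_mul_besselJ hν hx, gfun, sub_eq_neg_add,
    Real.rpow_add_one hx.ne']
  ring

theorem hypCoeff_add_one {c : ℝ} (hc : 0 < c) (n : ℕ) :
    hypCoeff (c + 1) n = c * (n + 1) * hypCoeff c (n + 1) := by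
  have h : (∏ j ∈ Finset.range n, (c + 1 + j)) * c = ∏ j ∈ Finset.range (n + 1), (c + j) := by
    rw [Finset.prod_range_succ']
    simp only [Nat.cast_add, Nat.cast_one, Nat.cast_zero, add_zero]
    exact congrArg (· * c) (Finset.prod_congr rfl fun j _ => by ring)
  have h' : 0 < ∏ j ∈ Finset.range n, (c + 1 + j) := Finset.prod_pos fun j _ => by positivity
  rw [hypCoeff, hypCoeff, ← h, Nat.factorial_succ]
  push_cast
  field_simp

theorem gderiv_eq {ν : ℝ} (hν : -1 < ν) {x : ℝ} (hx : 0 < x) :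
    gderiv ν x = diniSeries (ν + 1) ((x / 2) ^ 2) := by
  have hc : 0 < ν + 1 := by linarith
  have hshift := two_rpow_mul_rpow_mul_besselJ (ν := ν + 1) (by linarith) hx
  have h1 : (ν + 1) * (2 ^ ν * Real.Gamma (ν + 1) * x ^ (-ν) * (x * besselJ (ν + 1) x)) =
      (x ^ 2 / 2) * ∑' n : ℕ, hypCoeff (ν + 1 + 1) n * (-(x / 2) ^ 2) ^ n := by
    rw [← hshift, Real.Gamma_add_one hc.ne', neg_add, ← sub_eq_add_neg, Real.rpow_sub_one hx.ne',
      Real.rpow_add_one two_ne_zero]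
    field_simp
  have h2 : 2 ^ ν * Real.Gamma (ν + 1) * x ^ (-ν) * (x * besselJ (ν + 1) x) =
      -∑' n : ℕ, 2 * n * hypCoeff (ν + 1) n * (-(x / 2) ^ 2) ^ n := by
    have hs : Summable fun n : ℕ => 2 * n * hypCoeff (ν + 1) n * (-(x / 2) ^ 2) ^ n :=
      ((summable_diniSeries hc ((x / 2) ^ 2)).sub
        (summable_besselSeries hc ((x / 2) ^ 2))).congr fun n => by ring
    rw [← mul_right_inj' hc.ne', h1, hs.tsum_eq_zero_add, ← tsum_mul_left]
    simp only [Nat.cast_zero, mul_zero, zero_mul, zero_add]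
    rw [← tsum_neg, ← tsum_mul_left]
    refine tsum_congr fun n => ?_
    rw [hypCoeff_add_one hc, pow_succ]
    push_cast
    ring
  rw [gderiv, dini, mul_sub, h2, two_rpow_mul_rpow_mul_besselJ hν hx, sub_neg_eq_add,
    ← Summable.tsum_add (summable_besselSeries hc _), diniSeries]
  · exact tsum_congr fun n => by ring
  · exact ((summable_diniSeries hc ((x / 2) ^ 2)).sub
        (summable_besselSeries hc ((x / 2) ^ 2))).congr fun n => by ring

theorem integral_diniSeries {ν : ℝ} (hν : -1 < ν) {a b : ℝ} (ha : 0 < a) (hb : 0 < b) :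
    ∫ x in a..b, diniSeries (ν + 1) ((x / 2) ^ 2) = gfun ν b - gfun ν a := by
  have hc : 0 < ν + 1 := by linarith
  have hderiv : ∀ x, 0 < x →
      HasDerivAt (gfun ν) (diniSeries (ν + 1) ((x / 2) ^ 2)) x := by
    intro x hx
    have h : HasDerivAt (fun y => ∑' n : ℕ, hypCoeff (ν + 1) n * (-(y / 2) ^ 2) ^ n * y)
        (∑' n : ℕ, (2 * n + 1 : ℝ) * hypCoeff (ν + 1) n * (-(x / 2) ^ 2) ^ n) x := by
      refine hasDerivAt_tsum_of_isPreconnected (t := Ioo 0 (x + 1)) (y₀ := x)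
        (g' := fun (n : ℕ) y => (2 * n + 1 : ℝ) * hypCoeff (ν + 1) n * (-(y / 2) ^ 2) ^ n)
        (summable_hypCoeff hc (sq_nonneg ((x + 1) / 2))) isOpen_Ioo isPreconnected_Ioo
        (fun n y hy => ?_) (fun n y hy => ?_) ⟨hx, by linarith⟩
        ((summable_besselSeries hc _).mul_right x) ⟨hx, by linarith⟩
      · have hpow : ∀ z : ℝ, (-(z / 2) ^ 2) ^ n = (-1 / 4) ^ n * z ^ (2 * n) := fun z => by
          rw [pow_mul, ← mul_pow]
          ring_nf
        have h1 := (hasDerivAt_pow (2 * n + 1) y).const_mul (hypCoeff (ν + 1) n * (-1 / 4) ^ n)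
        simp only [hpow]
        refine (h1.congr_deriv ?_).congr_of_eventuallyEq (.of_forall fun z => ?_)
        · rw [Nat.add_sub_cancel]
          push_cast
          ring
        · ring
      · have h1 := (hypCoeff_pos hc n).le
        rw [norm_mul, norm_pow, norm_neg, Real.norm_of_nonneg (sq_nonneg _),
          Real.norm_of_nonneg (by positivity)]
        have := hy.1
        have := hy.2
        gcongr
    refine h.congr_of_eventuallyEq ?_
    filter_upwards [lt_mem_nhds hx] with y hy
    exact gfun_eq hν hy
  refine intervalIntegral.integral_eq_sub_of_hasDerivAt
    (fun x hx => hderiv x (lt_of_lt_of_le (lt_min ha hb) hx.1)) ?_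
  exact ((continuous_diniSeries hc).comp (by fun_prop)).intervalIntegrable _ _

theorem sub_mul_sqrt_gderiv_le {ν : ℝ} (hν : -1 < ν) {a b : ℝ} (ha : 0 < a) (hab : a ≤ b)
    (h0 : ∀ y ∈ Icc a b, dini ν y ≠ 0) :
    (b - a) * √(gderiv ν a * gderiv ν b) ≤ |gfun ν b - gfun ν a| := by
  have hc : 0 < ν + 1 := by linarith
  have hne : ∀ y ∈ Icc a b, diniSeries (ν + 1) ((y / 2) ^ 2) ≠ 0 := by
    intro y hy
    have hy0 : 0 < y := ha.trans_le hy.1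
    rw [← gderiv_eq hν hy0, gderiv]
    have := Real.Gamma_pos_of_pos hc
    exact mul_ne_zero (by positivity) (h0 y hy)
  rw [← integral_diniSeries hν ha (ha.trans_le hab), gderiv_eq hν ha,
    gderiv_eq hν (ha.trans_le hab)]
  refine sub_mul_sqrt_le_abs_integral (f := fun x => diniSeries (ν + 1) ((x / 2) ^ 2)) hab
    ((continuous_diniSeries hc).comp (by fun_prop)) hne fun x hx => ?_
  have h := diniSeries_mul_le hc (a := a / 2) (b := b / 2) (x := x / 2) (by positivity)
    ⟨by linarith [hx.1], by linarith [hx.2]⟩ fun y hy => by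
      have := hne (2 * y) ⟨by linarith [hy.1], by linarith [hy.2]⟩
      rwa [mul_div_cancel_left₀ _ two_ne_zero] at this
  rwa [← add_div, ← sub_div] at h

/-- Let `ν > -1`, with `α 1 < α 2 < ⋯` the positive zeros of `d_ν` and
`α 0 = 0`, and let `a, b` lie in the same component interval `(α (2k), α (2k+1))` of
`Δ_ν`.  Then the van der Corput type inequality
`|g_ν(a) - g_ν(b)| ≥ |a - b| √(g_ν'(a) g_ν'(b))` holds; equivalently,
`|a^{1-ν} J_ν(a) - b^{1-ν} J_ν(b)| ≥ |a - b| √((ab)^{-ν} d_ν(a) d_ν(b))`. -/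
theorem dini_van_der_corput (ν : ℝ) (hν : -1 < ν) (α : ℕ → ℝ)
    (hα0 : α 0 = 0) (hmono : StrictMono α)
    (hzeros : ∀ x : ℝ, (0 < x ∧ dini ν x = 0) ↔ ∃ n, 1 ≤ n ∧ α n = x)
    (k : ℕ) (a b : ℝ) (ha : a ∈ Set.Ioo (α (2 * k)) (α (2 * k + 1)))
    (hb : b ∈ Set.Ioo (α (2 * k)) (α (2 * k + 1))) :
    |gfun ν a - gfun ν b| ≥ |a - b| * Real.sqrt (gderiv ν a * gderiv ν b) ∧
    |a ^ (1 - ν) * besselJ ν a - b ^ (1 - ν) * besselJ ν b| ≥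
      |a - b| * Real.sqrt ((a * b) ^ (-ν) * dini ν a * dini ν b) := by
  have hαk : 0 ≤ α (2 * k) := hα0 ▸ hmono.monotone (Nat.zero_le _)
  have hne : ∀ y ∈ Ioo (α (2 * k)) (α (2 * k + 1)), dini ν y ≠ 0 := by
    intro y hy h
    obtain ⟨n, -, rfl⟩ := (hzeros y).1 ⟨hαk.trans_lt hy.1, h⟩
    have h1 := hmono.lt_iff_lt.1 hy.1
    have h2 := hmono.lt_iff_lt.1 hy.2
    omega
  have ha0 : 0 < a := hαk.trans_lt ha.1
  have hb0 : 0 < b := hαk.trans_lt hb.1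
  have hmain : |a - b| * √(gderiv ν a * gderiv ν b) ≤ |gfun ν a - gfun ν b| := by
    rcases le_total a b with h | h
    · rw [abs_sub_comm a b, abs_sub_comm (gfun ν a), abs_of_nonneg (sub_nonneg.2 h)]
      exact sub_mul_sqrt_gderiv_le hν ha0 h fun y hy =>
        hne y ⟨ha.1.trans_le hy.1, hy.2.trans_lt hb.2⟩
    · rw [abs_of_nonneg (sub_nonneg.2 h), mul_comm (gderiv ν a)]
      exact sub_mul_sqrt_gderiv_le hν hb0 h fun y hy =>
        hne y ⟨hb.1.trans_le hy.1, hy.2.trans_lt ha.2⟩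
  refine ⟨hmain, ?_⟩
  have hK : 0 < 2 ^ ν * Real.Gamma (ν + 1) :=
    mul_pos (Real.rpow_pos_of_pos two_pos ν) (Real.Gamma_pos_of_pos (by linarith))
  have h1 : gderiv ν a * gderiv ν b = (2 ^ ν * Real.Gamma (ν + 1)) ^ 2 *
      ((a * b) ^ (-ν) * dini ν a * dini ν b) := by
    rw [gderiv, gderiv, Real.mul_rpow ha0.le hb0.le]
    ring
  have h2 : gfun ν a - gfun ν b = 2 ^ ν * Real.Gamma (ν + 1) *
      (a ^ (1 - ν) * besselJ ν a - b ^ (1 - ν) * besselJ ν b) := by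
    rw [gfun, gfun]
    ring
  rw [h1, h2, Real.sqrt_mul (sq_nonneg _), Real.sqrt_sq hK.le, abs_mul, abs_of_pos hK,
    mul_left_comm] at hmain
  exact le_of_mul_le_mul_left hmain hK
end

section
/- Let a < b be real numbers and let f : [a, b] → ℝ be differentiable with derivative f' that is continuous, positive and log-concave on [a, b]. Then f(b) − f(a) ≥ (b − a) √(f'(a) f'(b)). -/
/-- A concave function on `[a, b]` satisfies `h a + h b ≤ h x + h (a + b - x)`. -/
lemma ConcaveOn.add_le_add_reflect {a b x : ℝ} {h : ℝ → ℝ} (hab : a < b)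
    (hh : ConcaveOn ℝ (Set.Icc a b) h) (hx : x ∈ Set.Icc a b) :
    h a + h b ≤ h x + h (a + b - x) := by
  have ha : a ∈ Set.Icc a b := Set.left_mem_Icc.2 hab.le
  have hb : b ∈ Set.Icc a b := Set.right_mem_Icc.2 hab.le
  have hne : b - a ≠ 0 := (sub_pos.2 hab).ne'
  have hs : 0 ≤ (b - x) / (b - a) := div_nonneg (sub_nonneg.2 hx.2) (sub_pos.2 hab).le
  have ht : 0 ≤ (x - a) / (b - a) := div_nonneg (sub_nonneg.2 hx.1) (sub_pos.2 hab).le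
  have hst : (b - x) / (b - a) + (x - a) / (b - a) = 1 := by field_simp; ring
  have h1 := hh.2 ha hb hs ht hst
  have h2 := hh.2 hb ha hs ht hst
  simp only [smul_eq_mul] at h1 h2
  have e1 : (b - x) / (b - a) * a + (x - a) / (b - a) * b = x := by field_simp; ring
  have e2 : (b - x) / (b - a) * b + (x - a) / (b - a) * a = a + b - x := by field_simp; ring
  rw [e1] at h1
  rw [e2] at h2
  linear_combination h1 + h2 - (h a + h b) * hst

/-- A log-concave positive function `g` on `[a, b]` satisfies
`2 √(g a * g b) ≤ g x + g (a + b - x)`. -/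
lemma two_mul_sqrt_le_add_reflect_of_log_concave {a b x : ℝ} {g : ℝ → ℝ} (hab : a < b)
    (hpos : ∀ x ∈ Set.Icc a b, 0 < g x)
    (hg : ConcaveOn ℝ (Set.Icc a b) (fun x => Real.log (g x))) (hx : x ∈ Set.Icc a b) :
    2 * Real.sqrt (g a * g b) ≤ g x + g (a + b - x) := by
  have ha := hpos a (Set.left_mem_Icc.2 hab.le)
  have hb := hpos b (Set.right_mem_Icc.2 hab.le)
  have hx' := hpos x hx
  have hy := hpos (a + b - x) ⟨by linarith [hx.2], by linarith [hx.1]⟩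
  have hlog := hg.add_le_add_reflect hab hx
  rw [← Real.log_mul ha.ne' hb.ne', ← Real.log_mul hx'.ne' hy.ne',
    Real.log_le_log_iff (mul_pos ha hb) (mul_pos hx' hy)] at hlog
  have : Real.sqrt (g a * g b) ≤ (g x + g (a + b - x)) / 2 :=
    Real.sqrt_le_iff.2 ⟨by positivity, by nlinarith [sq_nonneg (g x - g (a + b - x))]⟩
  linarith

open Real Filter Set

/-- Let `a < b` be real numbers and let `f : [a, b] → ℝ` be
differentiable with derivative `f'` that is continuous, positive and log-concave on
`[a, b]`.  Then `f(b) - f(a) ≥ (b - a) √(f'(a) f'(b))`. -/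
theorem log_concave_deriv_van_der_corput (a b : ℝ) (hab : a < b) (f f' : ℝ → ℝ)
    (hderiv : ∀ x ∈ Set.Icc a b, HasDerivWithinAt f (f' x) (Set.Icc a b) x)
    (hcont : ContinuousOn f' (Set.Icc a b))
    (hpos : ∀ x ∈ Set.Icc a b, 0 < f' x)
    (hlogconc : ConcaveOn ℝ (Set.Icc a b) (fun x => Real.log (f' x))) :
    f b - f a ≥ (b - a) * Real.sqrt (f' a * f' b) := by
  have hmaps : Set.MapsTo (fun x => a + b - x) (Set.Icc a b) (Set.Icc a b) :=
    fun x hx => ⟨by linarith [hx.2], by linarith [hx.1]⟩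
  have hG : ∀ x ∈ Set.Icc a b,
      HasDerivWithinAt (fun x => f x - f (a + b - x) - 2 * Real.sqrt (f' a * f' b) * x)
        (f' x + f' (a + b - x) - 2 * Real.sqrt (f' a * f' b)) (Set.Icc a b) x := by
    intro x hx
    have hr : HasDerivWithinAt (fun x => a + b - x) (-1) (Set.Icc a b) x :=
      (hasDerivWithinAt_id x _).const_sub (a + b)
    have hc := (hderiv _ (hmaps hx)).comp x hr hmaps
    have hl := (hasDerivWithinAt_id x (Set.Icc a b)).const_mul (2 * Real.sqrt (f' a * f' b))
    exact (((hderiv x hx).sub hc).sub hl).congr_deriv (by ring)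
  have hmono := monotoneOn_of_hasDerivWithinAt_nonneg (convex_Icc a b)
    (fun x hx => (hG x hx).continuousWithinAt)
    (fun x hx => (hG x (interior_subset hx)).mono interior_subset)
    (fun x hx => sub_nonneg.2
      (two_mul_sqrt_le_add_reflect_of_log_concave hab hpos hlogconc (interior_subset hx)))
  have h := hmono (Set.left_mem_Icc.2 hab.le) (Set.right_mem_Icc.2 hab.le) hab.le
  simp only [add_sub_cancel_left, add_sub_cancel_right] at h
  linarith
end

section
/- Let μ ≥ ν > −1 and let x ∈ (0, α_{ν,1}). Then 2^μ Γ(μ+1) x^{−μ} d_μ(x) ≥ 2^ν Γ(ν+1) x^{−ν} d_ν(x); equivalently, x^{ν−μ} d_μ(x)/d_ν(x) ≥ 2^{ν−μ} Γ(ν+1)/Γ(μ+1). More precisely, for each fixed x the function ν ↦ 2^ν Γ(ν+1) x^{−ν} d_ν(x) is increasing on the set of orders ν ∈ (−1, ∞) with x < α_{ν,1}. -/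
open Real Filter Set

open MeasureTheory ProbabilityTheory

/-- The coefficient sequence of a power series with infinite radius of convergence. -/
def EntireCoeff (a : ℕ → ℝ) : Prop := ∀ r : ℝ, Summable fun n => a n * r ^ n

/-- The sum of the power series with coefficients `a`. -/
noncomputable def seriesSum (a : ℕ → ℝ) (z : ℝ) : ℝ := ∑' n, a n * z ^ n

lemma EntireCoeff.mono {a b : ℕ → ℝ} (ha : EntireCoeff a) (h : ∀ n, |b n| ≤ |a n|) :
    EntireCoeff b := by
  intro r
  refine Summable.of_norm_bounded (ha r).abs fun n => ?_
  rw [Real.norm_eq_abs, abs_mul, abs_mul]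
  exact mul_le_mul_of_nonneg_right (h n) (abs_nonneg _)

lemma EntireCoeff.add {a b : ℕ → ℝ} (ha : EntireCoeff a) (hb : EntireCoeff b) :
    EntireCoeff fun n => a n + b n := by
  intro r
  simpa only [add_mul] using (ha r).add (hb r)

lemma EntireCoeff.const_mul {a : ℕ → ℝ} (ha : EntireCoeff a) (c : ℝ) :
    EntireCoeff fun n => c * a n := by
  intro r
  simpa only [mul_assoc] using (ha r).mul_left c

lemma EntireCoeff.natCast_mul {a : ℕ → ℝ} (ha : EntireCoeff a) :
    EntireCoeff fun n => (n : ℝ) * a n := by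
  intro r
  refine Summable.of_norm_bounded (ha (2 * r)).abs fun n => ?_
  have h2 : (n : ℝ) ≤ 2 ^ n := by exact_mod_cast Nat.lt_two_pow_self.le
  rw [Real.norm_eq_abs, abs_mul, abs_mul, abs_mul, mul_pow, abs_mul, Nat.abs_cast,
    abs_of_pos (by positivity : (0 : ℝ) < 2 ^ n)]
  calc (n : ℝ) * |a n| * |r ^ n| = n * (|a n| * |r ^ n|) := by ring
    _ ≤ 2 ^ n * (|a n| * |r ^ n|) := by gcongr
    _ = _ := by ring

lemma EntireCoeff.shift {a : ℕ → ℝ} (ha : EntireCoeff a) : EntireCoeff fun n => a (n + 1) := by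
  intro r
  rcases eq_or_ne r 0 with rfl | hr
  · exact summable_of_ne_finset_zero (s := {0}) fun n hn => by
      simp [zero_pow (by simpa using hn : n ≠ 0)]
  · refine (((summable_nat_add_iff 1).2 (ha r)).mul_left r⁻¹).congr fun n => ?_
    rw [pow_succ]
    field_simp

lemma seriesSum_continuous {a : ℕ → ℝ} (ha : EntireCoeff a) : Continuous (seriesSum a) := by
  rw [continuous_iff_continuousAt]
  intro z
  have hc : ContinuousOn (seriesSum a) (Metric.ball 0 (|z| + 1)) := by
    refine continuousOn_tsum (u := fun n => |a n * (|z| + 1) ^ n|) (fun n => by fun_prop)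
      (ha _).abs fun n s hs => ?_
    rw [mem_ball_zero_iff, Real.norm_eq_abs] at hs
    rw [Real.norm_eq_abs, abs_mul, abs_mul, abs_pow, abs_pow,
      abs_of_pos (by positivity : 0 < |z| + 1)]
    gcongr
  refine hc.continuousAt (Metric.isOpen_ball.mem_nhds ?_)
  simp

lemma seriesSum_zero (a : ℕ → ℝ) : seriesSum a 0 = a 0 := by
  rw [seriesSum, tsum_eq_single 0 fun n hn => by simp [hn]]
  simp

lemma integrable_pow_of_ae_mem_Icc {m : Measure ℝ} [IsFiniteMeasure m]
    (hm : ∀ᵐ t ∂m, t ∈ Icc (0 : ℝ) 1) (n : ℕ) : Integrable (fun t : ℝ => t ^ n) m := by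
  refine Integrable.of_bound (by fun_prop) 1 ?_
  filter_upwards [hm] with t ht
  rw [Real.norm_eq_abs, abs_of_nonneg (pow_nonneg ht.1 n)]
  exact pow_le_one₀ ht.1 ht.2

/-- Multiplying the coefficients by the moments of a measure on `[0, 1]` averages the series. -/
lemma hasSum_mul_moment {m : Measure ℝ} [IsFiniteMeasure m] (hm : ∀ᵐ t ∂m, t ∈ Icc (0 : ℝ) 1)
    {a : ℕ → ℝ} (ha : EntireCoeff a) (z : ℝ) :
    HasSum (fun n => a n * (∫ t, t ^ n ∂m) * z ^ n) (∫ t, seriesSum a (z * t) ∂m) := by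
  have key := hasSum_integral_of_summable_integral_norm (μ := m)
    (F := fun (n : ℕ) (t : ℝ) => a n * (z * t) ^ n) (fun n => ?_) ?_
  · have hterm : (fun n => a n * (∫ t, t ^ n ∂m) * z ^ n) =
        fun n => ∫ t, a n * (z * t) ^ n ∂m := by
      funext n
      simp_rw [mul_pow, ← mul_assoc, integral_const_mul]
      ring
    rw [hterm]
    exact key
  · simp_rw [mul_pow, ← mul_assoc]
    exact (integrable_pow_of_ae_mem_Icc hm n).const_mul _
  · refine Summable.of_nonneg_of_le (fun n => integral_nonneg fun t => norm_nonneg _)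
      (fun n => ?_) ((ha z).abs.mul_left (m.real univ))
    have hle : ∫ t, ‖a n * (z * t) ^ n‖ ∂m ≤ ∫ _, |a n * z ^ n| ∂m := by
      refine integral_mono_of_nonneg (ae_of_all _ fun t => norm_nonneg _) (integrable_const _) ?_
      filter_upwards [hm] with t ht
      rw [Real.norm_eq_abs, mul_pow, ← mul_assoc, abs_mul _ (t ^ n),
        abs_of_nonneg (pow_nonneg ht.1 n)]
      exact mul_le_of_le_one_right (abs_nonneg _) (pow_le_one₀ ht.1 ht.2)
    simpa using hle

lemma measureReal_mul_le_of_hasSum {m : Measure ℝ} [IsFiniteMeasure m]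
    (hm : ∀ᵐ t ∂m, t ∈ Icc (0 : ℝ) 1) {a b : ℕ → ℝ} (ha : EntireCoeff a) {z C : ℝ} (hz : 0 ≤ z)
    (hb : ∀ n, b n = a n * ∫ t, t ^ n ∂m) (hC : ∀ s ∈ Icc 0 z, C ≤ seriesSum a s) :
    m.real univ * C ≤ seriesSum b z := by
  have h := (hasSum_mul_moment hm ha z).tsum_eq
  simp_rw [← hb] at h
  rw [seriesSum, h]
  have hcont := (seriesSum_continuous ha).comp (continuous_const_mul z)
  have hint : Integrable (fun t => seriesSum a (z * t)) m := by
    obtain ⟨B, hB⟩ := isCompact_Icc.exists_bound_of_continuousOn (s := Icc (0 : ℝ) 1)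
      hcont.continuousOn
    refine Integrable.of_bound hcont.aestronglyMeasurable B ?_
    filter_upwards [hm] with t ht using hB t ht
  have hle : ∫ _, C ∂m ≤ ∫ t, seriesSum a (z * t) ∂m := by
    refine integral_mono_ae (integrable_const _) hint ?_
    filter_upwards [hm] with t ht
    exact hC _ ⟨mul_nonneg hz ht.1, mul_le_of_le_one_right hz ht.2⟩
  simpa using hle

lemma seriesSum_nonneg_of_moment {m : Measure ℝ} [IsFiniteMeasure m]
    (hm : ∀ᵐ t ∂m, t ∈ Icc (0 : ℝ) 1) {a b : ℕ → ℝ} (ha : EntireCoeff a)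
    (hb : ∀ n, b n = a n * ∫ t, t ^ n ∂m) {z : ℝ} (hC : ∀ s ∈ Icc 0 z, 0 ≤ seriesSum a s) :
    ∀ s ∈ Icc 0 z, 0 ≤ seriesSum b s := by
  intro s hs
  simpa using measureReal_mul_le_of_hasSum hm ha hs.1 hb
    fun t ht => hC t ⟨ht.1, ht.2.trans hs.2⟩

lemma seriesSum_le_of_deriv_nonpos {g : ℕ → ℝ} (hg : EntireCoeff g) {z s : ℝ} (hs : s ∈ Icc 0 z)
    (h : ∀ t ∈ Icc 0 z, 0 ≤ seriesSum (fun n => -((n + 1 : ℝ) * g (n + 1))) t) :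
    seriesSum g z ≤ seriesSum g s := by
  rcases (hs.1.trans hs.2).eq_or_lt with hz | hz
  · rw [le_antisymm hs.2 (hz ▸ hs.1)]
  obtain ⟨τ, hτ, rfl⟩ : ∃ τ ∈ Icc (0 : ℝ) 1, z * τ = s :=
    ⟨s / z, ⟨div_nonneg hs.1 hz.le, (div_le_one hz).2 hs.2⟩, by field_simp⟩
  have hm : ∀ᵐ t ∂(volume.restrict (Ioc τ 1)), t ∈ Icc (0 : ℝ) 1 := by
    filter_upwards [ae_restrict_mem measurableSet_Ioc] with t ht
    exact ⟨hτ.1.trans ht.1.le, ht.2⟩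
  have ha : EntireCoeff (fun n => -((n + 1 : ℝ) * g (n + 1))) := by
    have := (hg.natCast_mul.shift).const_mul (-1)
    simpa using this
  have hmom (n : ℕ) : ∫ t in Ioc τ 1, t ^ n = (1 - τ ^ (n + 1)) / (n + 1) := by
    rw [← intervalIntegral.integral_of_le hτ.2, integral_pow]
    simp
  have hnn := seriesSum_nonneg_of_moment hm ha (fun n => rfl) h z ⟨hz.le, le_rfl⟩
  have h1 := ((hg (z * τ)).sub (hg z)).tsum_eq_zero_add
  rw [(hg (z * τ)).tsum_sub (hg z)] at h1
  have h2 : ∑' n : ℕ, (g (n + 1) * (z * τ) ^ (n + 1) - g (n + 1) * z ^ (n + 1)) =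
      z * seriesSum (fun n => -((n + 1 : ℝ) * g (n + 1)) * ∫ t in Ioc τ 1, t ^ n) z := by
    rw [seriesSum, ← tsum_mul_left]
    refine tsum_congr fun n => ?_
    rw [hmom]
    field_simp
    ring
  rw [h2] at h1
  have h3 := mul_nonneg hz.le hnn
  simp only [pow_zero, mul_one, sub_self, zero_add] at h1
  simp only [seriesSum] at h1 h3 ⊢
  linarith

lemma ae_betaMeasure_mem_Icc (a b : ℝ) : ∀ᵐ t ∂(betaMeasure a b), t ∈ Icc (0 : ℝ) 1 := by
  have hmeas : Measurable (betaPDF a b) := (measurable_betaPDFReal a b).ennreal_ofReal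
  rw [betaMeasure, ae_withDensity_iff hmeas]
  refine ae_of_all _ fun t ht => ?_
  by_contra hc
  rw [mem_Icc, not_and_or, not_le, not_le] at hc
  rcases hc with h | h
  · exact ht (betaPDF_eq_zero_of_nonpos h.le)
  · exact ht (betaPDF_eq_zero_of_one_le h.le)

lemma betaPDFReal_nonneg {a b : ℝ} (ha : 0 < a) (hb : 0 < b) (t : ℝ) : 0 ≤ betaPDFReal a b t := by
  by_cases h : 0 < t ∧ t < 1
  · exact (betaPDFReal_pos h.1 h.2 ha hb).le
  · rw [betaPDFReal, if_neg h]

lemma integral_betaPDFReal {a b : ℝ} (ha : 0 < a) (hb : 0 < b) : ∫ t, betaPDFReal a b t = 1 := by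
  rw [integral_eq_lintegral_of_nonneg_ae (ae_of_all _ (betaPDFReal_nonneg ha hb))
    (by fun_prop)]
  have := lintegral_betaPDF_eq_one ha hb
  simp only [betaPDF] at this
  rw [this, ENNReal.toReal_one]

lemma integral_pow_betaMeasure {a b : ℝ} (ha : 0 < a) (hb : 0 < b) (n : ℕ) :
    ∫ t, t ^ n ∂(betaMeasure a b) = beta (a + n) b / beta a b := by
  have hmeas : Measurable (betaPDF a b) := (measurable_betaPDFReal a b).ennreal_ofReal
  have han : 0 < a + n := by positivity
  have h1 := (beta_pos ha hb).ne'
  have h2 := (beta_pos han hb).ne'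
  rw [betaMeasure, integral_withDensity_eq_integral_toReal_smul hmeas
    (ae_of_all _ fun t => ENNReal.ofReal_lt_top)]
  calc _ = ∫ t, beta (a + n) b / beta a b * betaPDFReal (a + n) b t := by
        refine integral_congr_ae (ae_of_all _ fun t => ?_)
        simp only [betaPDF, ENNReal.toReal_ofReal (betaPDFReal_nonneg ha hb t), smul_eq_mul]
        by_cases h : 0 < t ∧ t < 1
        · rw [betaPDFReal, betaPDFReal, if_pos h, if_pos h,
            show a + n - 1 = (a - 1) + n by ring, Real.rpow_add h.1, Real.rpow_natCast]
          field_simp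
        · rw [betaPDFReal, betaPDFReal, if_neg h, if_neg h]
          ring
    _ = _ := by rw [integral_const_mul, integral_betaPDFReal han hb, mul_one]

lemma integral_pow_betaMeasure_one {a : ℝ} (ha : 0 < a) (n : ℕ) :
    ∫ t, t ^ n ∂(betaMeasure a 1) = a / (a + n) := by
  have han : 0 < a + n := by positivity
  have h1 := (Real.Gamma_pos_of_pos ha).ne'
  have h2 := (Real.Gamma_pos_of_pos han).ne'
  rw [integral_pow_betaMeasure ha one_pos, beta, beta, Real.Gamma_add_one ha.ne',
    Real.Gamma_add_one han.ne']
  field_simp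

/-- The coefficients, in `z = x ^ 2 / 4`, of `2 ^ ν * Γ(ν + 1) * x ^ (-ν) * J_ν(x)`. -/
noncomputable def besselCoeff (ν : ℝ) (n : ℕ) : ℝ :=
  (-1) ^ n * Real.Gamma (ν + 1) / (n.factorial * Real.Gamma (n + ν + 1))

/-- The coefficients, in `z = x ^ 2 / 4`, of `2 ^ ν * Γ(ν + 1) * x ^ (-ν) * d_ν(x)`. -/
noncomputable def diniCoeff (ν : ℝ) (n : ℕ) : ℝ := (2 * n + 1) * besselCoeff ν n

lemma Gamma_natCast_add_pos {ν : ℝ} (hν : -1 < ν) (n : ℕ) : 0 < Real.Gamma (n + ν + 1) :=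
  Real.Gamma_pos_of_pos (by have : (0 : ℝ) ≤ n := n.cast_nonneg; linarith)

lemma besselCoeff_zero {ν : ℝ} (hν : -1 < ν) : besselCoeff ν 0 = 1 := by
  have h := Gamma_natCast_add_pos hν 0
  simp only [Nat.cast_zero, zero_add] at h
  simp [besselCoeff, h.ne']

lemma besselCoeff_ne_zero {ν : ℝ} (hν : -1 < ν) (n : ℕ) : besselCoeff ν n ≠ 0 := by
  have h := Gamma_natCast_add_pos hν n
  have h0 := Real.Gamma_pos_of_pos (by linarith : 0 < ν + 1)
  rw [besselCoeff]
  positivity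

lemma besselCoeff_succ {ν : ℝ} (hν : -1 < ν) (n : ℕ) :
    besselCoeff ν (n + 1) = -besselCoeff ν n / ((n + 1) * (n + ν + 1)) := by
  have hn : (0 : ℝ) < n + ν + 1 := by have : (0 : ℝ) ≤ n := n.cast_nonneg; linarith
  have h := Gamma_natCast_add_pos hν n
  rw [besselCoeff, besselCoeff, Nat.factorial_succ]
  push_cast
  rw [show (n : ℝ) + 1 + ν + 1 = (n + ν + 1) + 1 by ring, Real.Gamma_add_one hn.ne', pow_succ]
  field_simp

lemma entireCoeff_besselCoeff {ν : ℝ} (hν : -1 < ν) : EntireCoeff (besselCoeff ν) := by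
  have key : ∀ r : ℝ, r ≠ 0 → Summable fun n => besselCoeff ν n * r ^ n := by
    intro r hr
    refine summable_of_ratio_test_tendsto_lt_one zero_lt_one
      (Eventually.of_forall fun n => mul_ne_zero (besselCoeff_ne_zero hν n) (pow_ne_zero n hr)) ?_
    have h1 : Tendsto (fun n : ℕ => (n : ℝ) + 1) atTop atTop :=
      tendsto_atTop_add_const_right _ _ tendsto_natCast_atTop_atTop
    have h2 : Tendsto (fun n : ℕ => (n : ℝ) + ν + 1) atTop atTop :=
      tendsto_atTop_add_const_right _ _
        (tendsto_atTop_add_const_right _ _ tendsto_natCast_atTop_atTop)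
    refine ((h1.atTop_mul_atTop₀ h2).const_div_atTop |r|).congr fun n => ?_
    have hn : (0 : ℝ) < n + ν + 1 := by have : (0 : ℝ) ≤ n := n.cast_nonneg; linarith
    have hb := abs_pos.2 (besselCoeff_ne_zero hν n)
    have hr' := abs_pos.2 hr
    rw [besselCoeff_succ hν, Real.norm_eq_abs, Real.norm_eq_abs, abs_mul, abs_mul, abs_div,
      abs_neg, abs_pow, abs_pow, abs_of_pos (by positivity : 0 < ((n : ℝ) + 1) * (n + ν + 1)),
      pow_succ]
    field_simp
  intro r
  rcases eq_or_ne r 0 with rfl | hr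
  · exact summable_of_ne_finset_zero (s := {0}) fun n hn => by
      simp [zero_pow (by simpa using hn : n ≠ 0)]
  · exact key r hr

lemma entireCoeff_diniCoeff {ν : ℝ} (hν : -1 < ν) : EntireCoeff (diniCoeff ν) := by
  have h := entireCoeff_besselCoeff hν
  have := (h.natCast_mul.const_mul 2).add h
  refine this.mono fun n => le_of_eq ?_
  rw [diniCoeff]
  ring_nf

lemma besselJ_normalized {ν x : ℝ} (hx : 0 < x) :
    2 ^ ν * Real.Gamma (ν + 1) * x ^ (-ν) * besselJ ν x =
      seriesSum (besselCoeff ν) (x ^ 2 / 4) := by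
  rw [besselJ, seriesSum, ← tsum_mul_left]
  refine tsum_congr fun n => ?_
  have h2 : (2 : ℝ) ^ (2 * (n : ℝ) + ν) = 4 ^ n * 2 ^ ν := by
    rw [Real.rpow_add two_pos, Real.rpow_mul two_pos.le, Real.rpow_natCast]
    norm_num
  have h3 : x ^ (2 * (n : ℝ) + ν) = (x ^ 2) ^ n * x ^ ν := by
    rw [Real.rpow_add hx, Real.rpow_mul hx.le, Real.rpow_natCast]
    norm_num
  have h4 := (Real.rpow_pos_of_pos two_pos ν).ne'
  have h5 := (Real.rpow_pos_of_pos hx ν).ne'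
  rw [h2, h3, Real.rpow_neg hx.le, besselCoeff, div_pow]
  field_simp

lemma dini_normalized {ν x : ℝ} (hν : -1 < ν) (hx : 0 < x) :
    2 ^ ν * Real.Gamma (ν + 1) * x ^ (-ν) * dini ν x =
      seriesSum (diniCoeff ν) (x ^ 2 / 4) := by
  have hν1 : 0 < ν + 1 := by linarith
  have hc := entireCoeff_besselCoeff hν
  have h0 := besselJ_normalized (ν := ν) hx
  have h1 := besselJ_normalized (ν := ν + 1) hx
  rw [Real.Gamma_add_one hν1.ne', Real.rpow_add two_pos, Real.rpow_one, neg_add,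
    Real.rpow_add hx, Real.rpow_neg_one] at h1
  have h2 : seriesSum (diniCoeff ν) (x ^ 2 / 4) = seriesSum (besselCoeff ν) (x ^ 2 / 4) +
      2 * ∑' n : ℕ, (n : ℝ) * besselCoeff ν n * (x ^ 2 / 4) ^ n := by
    rw [seriesSum, seriesSum, ← tsum_mul_left,
      ← (hc _).tsum_add ((hc.natCast_mul _).mul_left 2)]
    refine tsum_congr fun n => ?_
    rw [diniCoeff]
    ring
  have h3 : ∑' n : ℕ, (n : ℝ) * besselCoeff ν n * (x ^ 2 / 4) ^ n =
      -(x ^ 2 / 4) / (ν + 1) * seriesSum (besselCoeff (ν + 1)) (x ^ 2 / 4) := by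
    rw [(hc.natCast_mul _).tsum_eq_zero_add, seriesSum, ← tsum_mul_left]
    simp only [Nat.cast_zero, zero_mul, zero_add]
    refine tsum_congr fun n => ?_
    have h := Gamma_natCast_add_pos hν (n + 1)
    rw [besselCoeff, besselCoeff, Real.Gamma_add_one hν1.ne', Nat.factorial_succ]
    push_cast at h ⊢
    rw [show (n : ℝ) + (ν + 1) + 1 = n + 1 + ν + 1 by ring, pow_succ, pow_succ]
    field_simp
  rw [h2, h3, ← h0, ← h1, dini]
  field_simp
  ring

lemma diniCoeff_eq_mul_moment {μ ν : ℝ} (hν : -1 < ν) (hμν : ν < μ) (n : ℕ) :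
    diniCoeff μ n = diniCoeff ν n * ∫ t, t ^ n ∂(betaMeasure (ν + 1) (μ - ν)) := by
  have h1 := Gamma_natCast_add_pos hν n
  have h2 := Gamma_natCast_add_pos (hν.trans hμν) n
  have h3 := Real.Gamma_pos_of_pos (by linarith : 0 < ν + 1)
  have h4 := Real.Gamma_pos_of_pos (by linarith : 0 < μ + 1)
  have h5 := Real.Gamma_pos_of_pos (by linarith : 0 < μ - ν)
  rw [integral_pow_betaMeasure (by linarith) (by linarith), beta, beta, diniCoeff, diniCoeff,
    besselCoeff, besselCoeff, show ν + 1 + n + (μ - ν) = n + μ + 1 by ring,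
    show ν + 1 + n = n + ν + 1 by ring, show ν + 1 + (μ - ν) = μ + 1 by ring]
  field_simp

lemma seriesSum_diniCoeff_le {ν z s : ℝ} (hν : -1 < ν)
    (hpos : ∀ t ∈ Icc 0 z, 0 ≤ seriesSum (diniCoeff ν) t) (hs : s ∈ Icc 0 z) :
    seriesSum (diniCoeff ν) z ≤ seriesSum (diniCoeff ν) s := by
  have hν1 : 0 < ν + 1 := by linarith
  have hc := entireCoeff_besselCoeff hν
  have hd := entireCoeff_diniCoeff hν
  have hhalf : (0 : ℝ) < 1 / 2 := by norm_num
  have := isProbabilityMeasureBeta hhalf one_pos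
  have := isProbabilityMeasureBeta hν1 one_pos
  have hJ : ∀ t ∈ Icc 0 z, 0 ≤ seriesSum (besselCoeff ν) t := by
    refine seriesSum_nonneg_of_moment (ae_betaMeasure_mem_Icc (1 / 2) 1) hd (fun n => ?_) hpos
    rw [integral_pow_betaMeasure_one hhalf, diniCoeff]
    field_simp
    ring
  have he : EntireCoeff fun n => (ν + 1)⁻¹ * (diniCoeff ν n + 2 * besselCoeff ν n) :=
    (hd.add (hc.const_mul 2)).const_mul _
  refine seriesSum_le_of_deriv_nonpos hd hs
    (seriesSum_nonneg_of_moment (ae_betaMeasure_mem_Icc (ν + 1) 1) he (fun n => ?_) fun t ht => ?_)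
  · have hn : (0 : ℝ) < n + ν + 1 := by have : (0 : ℝ) ≤ n := n.cast_nonneg; linarith
    rw [integral_pow_betaMeasure_one hν1, diniCoeff, diniCoeff, besselCoeff_succ hν,
      show ν + 1 + n = n + ν + 1 by ring]
    push_cast
    field_simp
    ring
  · have : seriesSum (fun n => (ν + 1)⁻¹ * (diniCoeff ν n + 2 * besselCoeff ν n)) t =
        (ν + 1)⁻¹ * (seriesSum (diniCoeff ν) t + 2 * seriesSum (besselCoeff ν) t) := by
      simp only [seriesSum]
      rw [← tsum_mul_left (a := (2 : ℝ)), ← (hd t).tsum_add ((hc t).mul_left 2), ← tsum_mul_left]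
      refine tsum_congr fun n => ?_
      ring
    rw [this]
    have h1 := hpos t ht
    have h2 := hJ t ht
    positivity

lemma seriesSum_diniCoeff_mono {μ ν z : ℝ} (hν : -1 < ν) (hμν : ν ≤ μ) (hz : 0 ≤ z)
    (hpos : ∀ t ∈ Icc 0 z, 0 ≤ seriesSum (diniCoeff ν) t) :
    seriesSum (diniCoeff ν) z ≤ seriesSum (diniCoeff μ) z := by
  rcases hμν.eq_or_lt with rfl | hlt
  · exact le_rfl
  have := isProbabilityMeasureBeta (by linarith : 0 < ν + 1) (by linarith : 0 < μ - ν)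
  simpa using measureReal_mul_le_of_hasSum (ae_betaMeasure_mem_Icc (ν + 1) (μ - ν))
    (entireCoeff_diniCoeff hν) hz (diniCoeff_eq_mul_moment hν hlt)
    fun s hs => seriesSum_diniCoeff_le hν hpos hs

lemma seriesSum_diniCoeff_pos {ν x : ℝ} (hν : -1 < ν) (hx : 0 < x)
    (h : ∀ y : ℝ, 0 < y → dini ν y = 0 → x < y) :
    ∀ t ∈ Icc 0 (x ^ 2 / 4), 0 < seriesSum (diniCoeff ν) t := by
  intro t ht
  by_contra hneg
  have h0 : 0 < seriesSum (diniCoeff ν) 0 := by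
    rw [seriesSum_zero, diniCoeff, besselCoeff_zero hν]
    norm_num
  obtain ⟨s, hs, hs0⟩ := intermediate_value_Icc' ht.1
    (seriesSum_continuous (entireCoeff_diniCoeff hν)).continuousOn ⟨not_lt.1 hneg, h0.le⟩
  have hspos : 0 < s := hs.1.lt_of_ne (by rintro rfl; exact h0.ne' hs0)
  have hy : 0 < 2 * √s := by positivity
  have hy2 : (2 * √s) ^ 2 / 4 = s := by
    rw [mul_pow, Real.sq_sqrt hspos.le]
    ring
  have hzero := dini_normalized hν hy
  rw [hy2, hs0] at hzero
  have hfac : 2 ^ ν * Real.Gamma (ν + 1) * (2 * √s) ^ (-ν) ≠ 0 := by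
    have := Real.Gamma_pos_of_pos (by linarith : 0 < ν + 1)
    positivity
  have hlt := h _ hy ((mul_eq_zero.1 hzero).resolve_left hfac)
  nlinarith [hs.2, ht.2]

/-- Let `μ ≥ ν > -1`, let `a1 t` denote the first positive zero of `d_t`
for every order `t > -1`, and let `x ∈ (0, a1 ν)`.  Then
`2^μ Γ(μ+1) x^{-μ} d_μ(x) ≥ 2^ν Γ(ν+1) x^{-ν} d_ν(x)`; equivalently,
`x^{ν-μ} d_μ(x)/d_ν(x) ≥ 2^{ν-μ} Γ(ν+1)/Γ(μ+1)`.  More precisely, for fixed `x` the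
function `t ↦ 2^t Γ(t+1) x^{-t} d_t(x)` is increasing on the set of orders `t ∈ (-1, ∞)`
with `x < a1 t`. -/
theorem dini_normalized_increasing_in_order (μ ν : ℝ) (hν : -1 < ν) (hμν : ν ≤ μ)
    (a1 : ℝ → ℝ)
    (ha1 : ∀ t : ℝ, -1 < t →
      0 < a1 t ∧ dini t (a1 t) = 0 ∧ ∀ y : ℝ, 0 < y → dini t y = 0 → a1 t ≤ y)
    (x : ℝ) (hx : x ∈ Set.Ioo (0 : ℝ) (a1 ν)) :
    2 ^ μ * Real.Gamma (μ + 1) * x ^ (-μ) * dini μ x ≥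
      2 ^ ν * Real.Gamma (ν + 1) * x ^ (-ν) * dini ν x ∧
    x ^ (ν - μ) * dini μ x / dini ν x ≥ 2 ^ (ν - μ) * Real.Gamma (ν + 1) / Real.Gamma (μ + 1) ∧
    MonotoneOn (fun t : ℝ => 2 ^ t * Real.Gamma (t + 1) * x ^ (-t) * dini t x)
      {t : ℝ | -1 < t ∧ x < a1 t} := by
  have hpos : ∀ t : ℝ, -1 < t → x < a1 t →
      ∀ s ∈ Icc 0 (x ^ 2 / 4), 0 < seriesSum (diniCoeff t) s := fun t ht hxt =>
    seriesSum_diniCoeff_pos ht hx.1 fun y hy h0 => hxt.trans_le ((ha1 t ht).2.2 y hy h0)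
  have hz : 0 ≤ x ^ 2 / 4 := by positivity
  have hμ : -1 < μ := hν.trans_le hμν
  have hmain := seriesSum_diniCoeff_mono hν hμν hz fun s hs => (hpos ν hν hx.2 s hs).le
  have hνpos := hpos ν hν hx.2 _ ⟨hz, le_rfl⟩
  rw [← dini_normalized hν hx.1, ← dini_normalized hμ hx.1] at hmain
  rw [← dini_normalized hν hx.1] at hνpos
  refine ⟨hmain, ?_, fun s hs t ht hst => ?_⟩
  · have hGν := Real.Gamma_pos_of_pos (by linarith : 0 < ν + 1)
    have hGμ := Real.Gamma_pos_of_pos (by linarith : 0 < μ + 1)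
    have h2ν := Real.rpow_pos_of_pos two_pos ν
    have h2μ := Real.rpow_pos_of_pos two_pos μ
    have hxν := Real.rpow_pos_of_pos hx.1 ν
    have hxμ := Real.rpow_pos_of_pos hx.1 μ
    rw [Real.rpow_neg hx.1.le] at hνpos
    have hd : 0 < dini ν x := pos_of_mul_pos_right hνpos (by positivity)
    rw [Real.rpow_neg hx.1.le, Real.rpow_neg hx.1.le] at hmain
    rw [Real.rpow_sub hx.1, Real.rpow_sub two_pos, ge_iff_le, div_le_div_iff₀ hGμ hd]
    field_simp at hmain ⊢
    linarith
  · simp only [dini_normalized hs.1 hx.1, dini_normalized ht.1 hx.1]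
    exact seriesSum_diniCoeff_mono hs.1 hst hz fun r hr => (hpos s hs.1 hs.2 r hr).le
end

section
/- Let μ ≥ ν > −1 and let x ∈ (0, α_{ν,1}). Then x d_μ'(x)/d_μ(x) ≥ x d_ν'(x)/d_ν(x); equivalently, d_μ'(x)/d_μ(x) ≥ d_ν'(x)/d_ν(x). More precisely, for each fixed x the function ν ↦ x d_ν'(x)/d_ν(x) is increasing on the set of orders ν ∈ (−1, ∞) with x < α_{ν,1}. -/
open Real Filter Set

open scoped Topology

/-- The entire function `z ↦ ∑ (-z)^n / (n! Γ(n+ν+1))`, for which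
`J_ν(x) = (x/2)^ν * besselClifford ν (x²/4)`. -/
noncomputable def besselClifford (ν z : ℝ) : ℝ :=
  ∑' n : ℕ, (-z) ^ n / ((n.factorial : ℝ) * Real.Gamma ((n : ℝ) + ν + 1))

/-- The Dini function with its power factor removed, in the variable `z = x²/4`. -/
noncomputable def diniClifford (ν z : ℝ) : ℝ :=
  besselClifford ν z - 2 * z * besselClifford (ν + 1) z

lemma natCast_add_add_one_pos {ν : ℝ} (hν : -1 < ν) (n : ℕ) : 0 < (n : ℝ) + ν + 1 := by
  have : (0 : ℝ) ≤ n := n.cast_nonneg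
  linarith

lemma summable_besselClifford {ν : ℝ} (hν : -1 < ν) (z : ℝ) :
    Summable fun n : ℕ => z ^ n / ((n.factorial : ℝ) * Real.Gamma ((n : ℝ) + ν + 1)) := by
  rcases eq_or_ne z 0 with rfl | hz
  · refine summable_of_ne_finset_zero (s := {0}) fun n hn => ?_
    rw [zero_pow (by simpa using hn), zero_div]
  have hΓ (n : ℕ) := Real.Gamma_pos_of_pos (natCast_add_add_one_pos hν n)
  refine summable_of_ratio_test_tendsto_lt_one (l := 0) zero_lt_one
    (Eventually.of_forall fun n => ?_) ?_
  · have := (hΓ n).ne'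
    positivity
  · have hlim : Tendsto (fun n : ℕ => |z| / ((n : ℝ) + 1) * (1 / ((n : ℝ) + (ν + 1)))) atTop
        (𝓝 (0 * 0)) := by
      refine Tendsto.mul ?_ ?_
      · exact tendsto_const_nhds.div_atTop
          (tendsto_atTop_add_const_right _ _ tendsto_natCast_atTop_atTop)
      · exact tendsto_const_nhds.div_atTop
          (tendsto_atTop_add_const_right _ _ tendsto_natCast_atTop_atTop)
    rw [zero_mul] at hlim
    refine hlim.congr fun n => ?_
    have h1 := natCast_add_add_one_pos hν n
    have h2 := hΓ n
    have hrec : Real.Gamma (((n + 1 : ℕ) : ℝ) + ν + 1) =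
        ((n : ℝ) + ν + 1) * Real.Gamma ((n : ℝ) + ν + 1) := by
      rw [← Real.Gamma_add_one h1.ne']
      push_cast
      ring_nf
    have hfac : (0 : ℝ) < n.factorial := by positivity
    have hn : (0 : ℝ) < (n : ℝ) + 1 := by positivity
    rw [hrec, Nat.factorial_succ]
    push_cast
    simp only [norm_div, norm_mul, norm_pow, Real.norm_eq_abs, abs_of_pos h1, abs_of_pos h2,
      abs_of_pos hfac, abs_of_pos hn]
    have hz' : |z| ≠ 0 := abs_ne_zero.2 hz
    have h1' : (n : ℝ) + (ν + 1) ≠ 0 := by linarith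
    field_simp
    ring

lemma besselClifford_zero_pos {ν : ℝ} (hν : -1 < ν) : 0 < besselClifford ν 0 := by
  have h : besselClifford ν 0 = 1 / Real.Gamma (ν + 1) := by
    rw [besselClifford, tsum_eq_single 0]
    · simp
    · intro n hn
      simp [hn]
  rw [h]
  exact one_div_pos.2 (Real.Gamma_pos_of_pos (by linarith))

lemma hasDerivAt_besselClifford {ν : ℝ} (hν : -1 < ν) (z : ℝ) :
    HasDerivAt (besselClifford ν) (-besselClifford (ν + 1) z) z := by
  set R : ℝ := |z| + 1
  have hR : 0 < R := by positivity
  let a : ℕ → ℝ := fun n => (n.factorial : ℝ) * Real.Gamma ((n : ℝ) + ν + 1)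
  let g' : ℕ → ℝ → ℝ := fun n y => n * (-y) ^ (n - 1) * (-1) / a n
  have hshift (n : ℕ) (y : ℝ) : g' (n + 1) y =
      -((-y) ^ n / ((n.factorial : ℝ) * Real.Gamma ((n : ℝ) + (ν + 1) + 1))) := by
    have hfac : (n.factorial : ℝ) ≠ 0 := by positivity
    have hn : (n : ℝ) + 1 ≠ 0 := by positivity
    have hΓ : Real.Gamma ((n : ℝ) + (ν + 1) + 1) ≠ 0 :=
      (Real.Gamma_pos_of_pos (natCast_add_add_one_pos (by linarith) n)).ne'
    simp only [g', a]
    rw [Nat.factorial_succ]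
    push_cast
    rw [show (n : ℝ) + 1 + ν + 1 = (n : ℝ) + (ν + 1) + 1 by ring]
    field_simp
  have hu : Summable fun n : ℕ => ‖g' n R‖ := by
    refine Summable.norm ?_
    rw [← summable_nat_add_iff 1]
    simp only [hshift]
    exact (summable_besselClifford (by linarith) (-R)).neg
  have hderiv : HasDerivAt (besselClifford ν) (∑' n, g' n z) z := by
    refine hasDerivAt_tsum_of_isPreconnected (t := Metric.ball 0 R) (y₀ := 0) hu Metric.isOpen_ball
      (convex_ball _ _).isPreconnected (fun n y _ => ?_) (fun n y hy => ?_)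
      (Metric.mem_ball_self hR) ?_ ?_
    · exact (((hasDerivAt_id y).neg).pow n).div_const _
    · have hy' : |y| ≤ |R| := by
        rw [abs_of_pos hR]
        simpa using (Metric.mem_ball.1 hy).le
      simp only [g', norm_div, norm_mul, norm_pow, norm_neg, Real.norm_eq_abs]
      gcongr
    · simpa using summable_besselClifford hν (-0)
    · simp [R]
  refine hderiv.congr_deriv ?_
  have hs : Summable fun n => g' n z := by
    rw [← summable_nat_add_iff 1]
    simp only [hshift]
    exact (summable_besselClifford (by linarith) (-z)).neg
  rw [hs.tsum_eq_zero_add]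
  simp only [hshift]
  rw [tsum_neg]
  simp [g', besselClifford]

lemma besselClifford_recurrence {ν : ℝ} (hν : -1 < ν) (z : ℝ) :
    z * besselClifford (ν + 2) z =
      (ν + 1) * besselClifford (ν + 1) z - besselClifford ν z := by
  have h0 := summable_besselClifford hν (-z)
  have h1 := summable_besselClifford (ν := ν + 1) (by linarith) (-z)
  have hs := (h1.mul_left (ν + 1)).sub h0
  rw [besselClifford, besselClifford, besselClifford, ← tsum_mul_left, ← tsum_mul_left,
    ← (h1.mul_left (ν + 1)).tsum_sub h0, hs.tsum_eq_zero_add]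
  have hΓ0 : Real.Gamma (ν + 1) ≠ 0 := (Real.Gamma_pos_of_pos (by linarith)).ne'
  have hν1 : ν + 1 ≠ 0 := by linarith
  have hzero : (ν + 1) * ((-z) ^ 0 / (((0 : ℕ).factorial : ℝ) *
      Real.Gamma (((0 : ℕ) : ℝ) + (ν + 1) + 1))) -
      (-z) ^ 0 / (((0 : ℕ).factorial : ℝ) * Real.Gamma (((0 : ℕ) : ℝ) + ν + 1)) = 0 := by
    simp only [Nat.cast_zero, zero_add, Real.Gamma_add_one hν1, Nat.factorial_zero, Nat.cast_one,
      pow_zero, one_mul]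
    field_simp
    simp
  rw [hzero, zero_add]
  refine tsum_congr fun n => ?_
  have hpos : 0 < (n : ℝ) + ν + 2 := by linarith [natCast_add_add_one_pos hν n]
  have hΓ : Real.Gamma ((n : ℝ) + ν + 2) ≠ 0 := (Real.Gamma_pos_of_pos hpos).ne'
  have hfac : (n.factorial : ℝ) ≠ 0 := by positivity
  have hn : (n : ℝ) + 1 ≠ 0 := by positivity
  have hp := hpos.ne'
  rw [Nat.factorial_succ]
  push_cast
  rw [show (n : ℝ) + (ν + 2) + 1 = (n : ℝ) + ν + 2 + 1 by ring,
    show (n : ℝ) + 1 + (ν + 1) + 1 = (n : ℝ) + ν + 2 + 1 by ring,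
    show (n : ℝ) + 1 + ν + 1 = (n : ℝ) + ν + 2 by ring, Real.Gamma_add_one hp]
  field_simp
  ring

lemma continuous_besselClifford {ν : ℝ} (hν : -1 < ν) : Continuous (besselClifford ν) :=
  continuous_iff_continuousAt.2 fun z => (hasDerivAt_besselClifford hν z).continuousAt

lemma hasDerivAt_besselClifford_add_one {ν z : ℝ} (hν : -1 < ν) (hz : z ≠ 0) :
    HasDerivAt (besselClifford (ν + 1))
      ((besselClifford ν z - (ν + 1) * besselClifford (ν + 1) z) / z) z := by
  refine (hasDerivAt_besselClifford (ν := ν + 1) (by linarith) z).congr_deriv ?_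
  have := besselClifford_recurrence hν z
  rw [show ν + 1 + 1 = ν + 2 by ring, eq_div_iff hz]
  linarith

lemma hasDerivAt_diniClifford {ν z : ℝ} (hν : -1 < ν) (hz : z ≠ 0) :
    HasDerivAt (diniClifford ν)
      (-2 * besselClifford ν z + (2 * ν - 1) * besselClifford (ν + 1) z) z := by
  refine ((hasDerivAt_besselClifford hν z).sub (((hasDerivAt_id z).const_mul 2).mul
    (hasDerivAt_besselClifford_add_one hν hz))).congr_deriv ?_
  simp only [id]
  field_simp
  ring

lemma continuous_diniClifford {ν : ℝ} (hν : -1 < ν) : Continuous (diniClifford ν) :=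
  (continuous_besselClifford hν).sub
    ((continuous_const.mul continuous_id).mul (continuous_besselClifford (by linarith)))

lemma besselJ_eq (ν : ℝ) {x : ℝ} (hx : 0 < x) :
    besselJ ν x = (x / 2) ^ ν * besselClifford ν (x ^ 2 / 4) := by
  rw [besselJ, besselClifford, ← tsum_mul_left]
  refine tsum_congr fun n => ?_
  have hpow (y : ℝ) (hy : 0 < y) : y ^ (2 * (n : ℝ) + ν) = (y ^ 2) ^ n * y ^ ν := by
    rw [Real.rpow_add hy, ← pow_mul, ← Real.rpow_natCast]
    push_cast
    rfl
  rw [hpow x hx, hpow 2 two_pos, Real.div_rpow hx.le two_pos.le, neg_pow (x ^ 2 / 4), div_pow]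
  norm_num
  ring

lemma dini_eq (ν : ℝ) {x : ℝ} (hx : 0 < x) :
    dini ν x = (x / 2) ^ ν * diniClifford ν (x ^ 2 / 4) := by
  rw [dini, besselJ_eq ν hx, besselJ_eq (ν + 1) hx, Real.rpow_add_one (by positivity),
    diniClifford]
  ring

lemma dini_logDeriv {ν x : ℝ} (hν : -1 < ν) (hx : 0 < x)
    (hD : diniClifford ν (x ^ 2 / 4) ≠ 0) :
    x * deriv (dini ν) x / dini ν x =
      ν + 2 * (x ^ 2 / 4) * (-2 * besselClifford ν (x ^ 2 / 4) +
        (2 * ν - 1) * besselClifford (ν + 1) (x ^ 2 / 4)) / diniClifford ν (x ^ 2 / 4) := by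
  have hsq : HasDerivAt (fun y : ℝ => y ^ 2 / 4) (x / 2) x := by
    refine ((hasDerivAt_pow 2 x).div_const 4).congr_deriv ?_
    push_cast
    ring
  have hpow : HasDerivAt (fun y : ℝ => (y / 2) ^ ν) (1 / 2 * ν * (x / 2) ^ (ν - 1)) x :=
    ((hasDerivAt_id x).div_const 2).rpow_const (Or.inl (by simp [hx.ne']))
  have hder := hpow.fun_mul
    ((hasDerivAt_diniClifford (z := x ^ 2 / 4) hν (by positivity)).comp x hsq)
  have heq : dini ν =ᶠ[𝓝 x] fun y => (y / 2) ^ ν * diniClifford ν (y ^ 2 / 4) := by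
    filter_upwards [lt_mem_nhds hx] with y hy using dini_eq ν hy
  simp only [Function.comp] at hder
  rw [heq.deriv_eq, dini_eq ν hx, hder.deriv]
  have hp : (x / 2) ^ ν ≠ 0 := (Real.rpow_pos_of_pos (by positivity) ν).ne'
  rw [Real.rpow_sub_one (by positivity)]
  field_simp
  ring

lemma hasDerivAt_rpow_mul {f : ℝ → ℝ} {f' c z : ℝ} (hz : 0 < z) (hf : HasDerivAt f f' z) :
    HasDerivAt (fun y => y ^ c * f y) (z ^ (c - 1) * (c * f z + z * f')) z := by
  refine ((Real.hasDerivAt_rpow_const (p := c) (Or.inl hz.ne')).mul hf).congr_deriv ?_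
  rw [Real.rpow_sub_one hz.ne']
  field_simp

lemma pos_of_euler_pos {f : ℝ → ℝ} {c Z : ℝ} (hc : 0 < c) (hf : ContinuousOn f (Icc 0 Z))
    (h : ∀ z ∈ Ioo 0 Z, ∃ f', HasDerivAt f f' z ∧ 0 < c * f z + z * f')
    {z : ℝ} (hz : z ∈ Ioc 0 Z) : 0 < f z := by
  have hmono : StrictMonoOn (fun y => y ^ c * f y) (Icc 0 Z) := by
    refine strictMonoOn_of_deriv_pos (convex_Icc _ _)
      ((Real.continuous_rpow_const hc.le).continuousOn.mul hf) fun y hy => ?_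
    rw [interior_Icc] at hy
    obtain ⟨f', hf', hpos⟩ := h y hy
    rw [(hasDerivAt_rpow_mul hy.1 hf').deriv]
    exact mul_pos (Real.rpow_pos_of_pos hy.1 _) hpos
  have := hmono ⟨le_rfl, hz.1.le.trans hz.2⟩ ⟨hz.1.le, hz.2⟩ hz.1
  simp only [Real.zero_rpow hc.ne', zero_mul] at this
  exact pos_of_mul_pos_right this (Real.rpow_nonneg hz.1.le _)

lemma nonneg_of_euler_nonneg {f : ℝ → ℝ} {c Z : ℝ} (hc : 0 < c)
    (hf : ContinuousOn f (Icc 0 Z))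
    (h : ∀ z ∈ Ioo 0 Z, ∃ f', HasDerivAt f f' z ∧ 0 ≤ c * f z + z * f')
    {z : ℝ} (hz : z ∈ Ioc 0 Z) : 0 ≤ f z := by
  have hmono : MonotoneOn (fun y => y ^ c * f y) (Icc 0 Z) := by
    refine monotoneOn_of_deriv_nonneg (convex_Icc _ _)
      ((Real.continuous_rpow_const hc.le).continuousOn.mul hf) (fun y hy => ?_) fun y hy => ?_
    all_goals
      rw [interior_Icc] at hy
      obtain ⟨f', hf', hnonneg⟩ := h y hy
      have hder := hasDerivAt_rpow_mul (c := c) hy.1 hf'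
    · exact hder.differentiableAt.differentiableWithinAt
    · rw [hder.deriv]
      exact mul_nonneg (Real.rpow_nonneg hy.1.le _) hnonneg
  have := hmono ⟨le_rfl, hz.1.le.trans hz.2⟩ ⟨hz.1.le, hz.2⟩ hz.1.le
  simp only [Real.zero_rpow hc.ne', zero_mul] at this
  exact nonneg_of_mul_nonneg_right this (Real.rpow_pos_of_pos hz.1 _)

lemma besselClifford_pos {ν Z : ℝ} (hν : -1 < ν) (hD : ∀ z ∈ Ioo 0 Z, 0 < diniClifford ν z)
    {z : ℝ} (hz : z ∈ Ioc 0 Z) : 0 < besselClifford ν z := by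
  refine pos_of_euler_pos (c := 1 / 2) (by norm_num) (continuous_besselClifford hν).continuousOn
    (fun y hy => ⟨_, hasDerivAt_besselClifford hν y, ?_⟩) hz
  have := hD y hy
  rw [diniClifford] at this
  linarith

lemma besselClifford_add_one_pos {ν Z : ℝ} (hν : -1 < ν)
    (hD : ∀ z ∈ Ioo 0 Z, 0 < diniClifford ν z) {z : ℝ} (hz : z ∈ Ioc 0 Z) :
    0 < besselClifford (ν + 1) z := by
  refine pos_of_euler_pos (c := ν + 1) (by linarith)
    (continuous_besselClifford (by linarith)).continuousOn
    (fun y hy => ⟨_, hasDerivAt_besselClifford_add_one hν hy.1.ne', ?_⟩) hz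
  have hy0 := hy.1.ne'
  have := besselClifford_pos hν hD ⟨hy.1, hy.2.le⟩
  field_simp
  linarith

/-- A Turán-type inequality, expressing that `x J_{ν+1}(x) / J_ν(x)` is increasing in `x`. -/
lemma besselClifford_turan {ν z : ℝ} (hν : -1 < ν) (hz : 0 < z) :
    0 ≤ besselClifford ν z ^ 2 - ν * besselClifford ν z * besselClifford (ν + 1) z +
      z * besselClifford (ν + 1) z ^ 2 := by
  have hA := continuous_besselClifford hν
  have hB := continuous_besselClifford (ν := ν + 1) (by linarith)
  refine nonneg_of_euler_nonneg (Z := z) (c := ν + 1) (f := fun z => besselClifford ν z ^ 2 -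
      ν * besselClifford ν z * besselClifford (ν + 1) z + z * besselClifford (ν + 1) z ^ 2)
    (by linarith) (by fun_prop) (fun y hy => ?_) ⟨hz, le_rfl⟩
  have hA' := hasDerivAt_besselClifford hν y
  have hB' := hasDerivAt_besselClifford_add_one hν hy.1.ne'
  refine ⟨_, ((hA'.pow 2).sub ((hA'.const_mul ν).mul hB')).add
    ((hasDerivAt_id y).mul (hB'.pow 2)), ?_⟩
  have hy0 := hy.1.ne'
  refine (sq_nonneg (besselClifford ν y)).trans_eq ?_
  simp only [id]
  field_simp
  ring

/-- Expresses that `J_{ν+1}(x) / J_ν(x)` is decreasing in the order. -/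
lemma besselClifford_cross_nonneg {ν μ Z : ℝ} (hν : -1 < ν) (hμ : ν ≤ μ)
    (hDν : ∀ z ∈ Ioo 0 Z, 0 < diniClifford ν z) (hDμ : ∀ z ∈ Ioo 0 Z, 0 < diniClifford μ z)
    {z : ℝ} (hz : z ∈ Ioc 0 Z) :
    0 ≤ besselClifford (ν + 1) z * besselClifford μ z -
      besselClifford (μ + 1) z * besselClifford ν z := by
  have hμ' : -1 < μ := by linarith
  have hA := continuous_besselClifford hν
  have hB := continuous_besselClifford (ν := ν + 1) (by linarith)
  have hP := continuous_besselClifford hμ'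
  have hQ := continuous_besselClifford (ν := μ + 1) (by linarith)
  refine nonneg_of_euler_nonneg (Z := Z) (c := ν + 1)
    (f := fun z => besselClifford (ν + 1) z * besselClifford μ z -
      besselClifford (μ + 1) z * besselClifford ν z)
    (by linarith) (by fun_prop) (fun y hy => ?_) hz
  refine ⟨_, ((hasDerivAt_besselClifford_add_one hν hy.1.ne').mul
      (hasDerivAt_besselClifford hμ' y)).sub
    ((hasDerivAt_besselClifford_add_one hμ' hy.1.ne').mul (hasDerivAt_besselClifford hν y)), ?_⟩
  have hy0 := hy.1.ne'
  have h1 := besselClifford_pos hν hDν ⟨hy.1, hy.2.le⟩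
  have h2 := besselClifford_add_one_pos hμ' hDμ ⟨hy.1, hy.2.le⟩
  have h3 : 0 ≤ (μ - ν) * besselClifford (μ + 1) y * besselClifford ν y :=
    mul_nonneg (mul_nonneg (by linarith) h2.le) h1.le
  refine h3.trans_eq ?_
  field_simp
  ring

/-- Expresses that `x J_{ν+1}(x) / J_ν(x) - x J_{μ+1}(x) / J_μ(x)` is increasing in `x`. -/
lemma besselClifford_ratio_sub_deriv_nonneg {ν μ Z : ℝ} (hν : -1 < ν) (hμ : ν ≤ μ)
    (hDν : ∀ z ∈ Ioo 0 Z, 0 < diniClifford ν z) (hDμ : ∀ z ∈ Ioo 0 Z, 0 < diniClifford μ z)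
    {z : ℝ} (hz : z ∈ Ioc 0 Z) :
    0 ≤ (besselClifford (ν + 1) z * besselClifford μ z -
          besselClifford (μ + 1) z * besselClifford ν z) *
        (z * (besselClifford (ν + 1) z / besselClifford ν z +
          besselClifford (μ + 1) z / besselClifford μ z) - ν) +
      (μ - ν) * besselClifford (μ + 1) z * besselClifford ν z := by
  have hμ' : -1 < μ := by linarith
  have hA := continuous_besselClifford hν
  have hB := continuous_besselClifford (ν := ν + 1) (by linarith)
  have hP := continuous_besselClifford hμ'
  have hQ := continuous_besselClifford (ν := μ + 1) (by linarith)
  have hne {κ : ℝ} (hκ : -1 < κ) (hD : ∀ z ∈ Ioo 0 Z, 0 < diniClifford κ z) (y : ℝ)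
      (hy : y ∈ Icc 0 Z) : besselClifford κ y ≠ 0 := by
    rcases hy.1.eq_or_lt with rfl | hy'
    · exact (besselClifford_zero_pos hκ).ne'
    · exact (besselClifford_pos hκ hD ⟨hy', hy.2⟩).ne'
  refine nonneg_of_euler_nonneg (Z := Z) (c := ν + 1)
    (f := fun z => (besselClifford (ν + 1) z * besselClifford μ z -
          besselClifford (μ + 1) z * besselClifford ν z) *
        (z * (besselClifford (ν + 1) z / besselClifford ν z +
          besselClifford (μ + 1) z / besselClifford μ z) - ν) +
      (μ - ν) * besselClifford (μ + 1) z * besselClifford ν z)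
    (by linarith) ?_ (fun y hy => ?_) hz
  · have h1 : ContinuousOn (fun z => besselClifford (ν + 1) z / besselClifford ν z) (Icc 0 Z) :=
      hB.continuousOn.div hA.continuousOn (hne hν hDν)
    have h2 : ContinuousOn (fun z => besselClifford (μ + 1) z / besselClifford μ z) (Icc 0 Z) :=
      hQ.continuousOn.div hP.continuousOn (hne hμ' hDμ)
    fun_prop
  · have hA' := hasDerivAt_besselClifford hν y
    have hB' := hasDerivAt_besselClifford_add_one hν hy.1.ne'
    have hP' := hasDerivAt_besselClifford hμ' y
    have hQ' := hasDerivAt_besselClifford_add_one hμ' hy.1.ne'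
    have hyI : y ∈ Icc 0 Z := ⟨hy.1.le, hy.2.le⟩
    refine ⟨_, (((hB'.mul hP').sub (hQ'.mul hA')).mul
      (((hasDerivAt_id y).mul ((hB'.div hA' (hne hν hDν y hyI)).add
        (hQ'.div hP' (hne hμ' hDμ y hyI)))).sub_const ν)).add
      ((hQ'.const_mul (μ - ν)).mul hA'), ?_⟩
    have hy0 := hy.1.ne'
    have hy' : y ∈ Ioc 0 Z := ⟨hy.1, hy.2.le⟩
    have hE := besselClifford_cross_nonneg hν hμ hDν hDμ hy'
    have hVν := besselClifford_turan hν hy.1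
    have hVμ := besselClifford_turan hμ' hy.1
    have hApos := besselClifford_pos hν hDν hy'
    have hPpos := besselClifford_pos hμ' hDμ hy'
    simp only [id, Pi.add_apply, Pi.mul_apply, Pi.div_apply, Pi.sub_apply]
    set A := besselClifford ν y
    set B := besselClifford (ν + 1) y
    set P := besselClifford μ y
    set Q := besselClifford (μ + 1) y
    have hy1 := hy.1
    have hδ : 0 ≤ μ - ν := by linarith
    have key : 0 ≤ y * (B * P - Q * A) * ((A ^ 2 - ν * A * B + y * B ^ 2) / A ^ 2 +
        (P ^ 2 - μ * P * Q + y * Q ^ 2) / P ^ 2) +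
        (μ - ν) * A * ((P ^ 2 - μ * P * Q + y * Q ^ 2) / P) := by positivity
    refine key.trans_eq ?_
    field_simp
    ring

lemma diniClifford_logDeriv_le {ν μ Z : ℝ} (hν : -1 < ν) (hμ : ν ≤ μ)
    (hDν : ∀ z ∈ Ioo 0 Z, 0 < diniClifford ν z) (hDμ : ∀ z ∈ Ioo 0 Z, 0 < diniClifford μ z)
    {z : ℝ} (hz : z ∈ Ioo 0 Z) :
    ν + 2 * z * (-2 * besselClifford ν z + (2 * ν - 1) * besselClifford (ν + 1) z) /
        diniClifford ν z ≤
      μ + 2 * z * (-2 * besselClifford μ z + (2 * μ - 1) * besselClifford (μ + 1) z) /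
        diniClifford μ z := by
  have hμ' : -1 < μ := by linarith
  have hz' : z ∈ Ioc 0 Z := ⟨hz.1, hz.2.le⟩
  have hz0 := hz.1
  have hE := besselClifford_cross_nonneg hν hμ hDν hDμ hz'
  have hW := besselClifford_ratio_sub_deriv_nonneg hν hμ hDν hDμ hz'
  have hV := besselClifford_turan hν hz.1
  have hA := besselClifford_pos hν hDν hz'
  have hP := besselClifford_pos hμ' hDμ hz'
  have hQ := besselClifford_add_one_pos hμ' hDμ hz'
  have hD1 := hDν z hz
  have hD2 := hDμ z hz
  rw [diniClifford] at hD1 hD2 ⊢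
  rw [diniClifford]
  set A := besselClifford ν z
  set B := besselClifford (ν + 1) z
  set P := besselClifford μ z
  set Q := besselClifford (μ + 1) z
  obtain ⟨h, hh⟩ : ∃ h, h = 2 * z * B / A := ⟨_, rfl⟩
  obtain ⟨k, hk⟩ : ∃ k, k = 2 * z * Q / P := ⟨_, rfl⟩
  have hkpos : 0 < k := by rw [hk]; positivity
  have hh1 : h < 1 := by rw [hh, div_lt_one hA]; linarith
  have hk1 : k < 1 := by rw [hk, div_lt_one hP]; linarith
  have he : 0 ≤ h - k := by
    have : h - k = 2 * z * (B * P - Q * A) / (A * P) := by rw [hh, hk]; field_simp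
    rw [this]
    positivity
  have hv : 0 ≤ 4 * z - 2 * ν * h + h ^ 2 := by
    have : 4 * z - 2 * ν * h + h ^ 2 = 4 * z * (A ^ 2 - ν * A * B + z * B ^ 2) / A ^ 2 := by
      rw [hh]; field_simp; ring
    rw [this]
    positivity
  have hw : (h - k) * (2 * ν - h - k) ≤ 2 * (μ - ν) * k := by
    have : 2 * (μ - ν) * k - (h - k) * (2 * ν - h - k) = 4 * z * ((B * P - Q * A) *
        (z * (B / A + Q / P) - ν) + (μ - ν) * Q * A) / (A * P) := by
      rw [hh, hk]; field_simp; ring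
    have h0 : 0 ≤ 2 * (μ - ν) * k - (h - k) * (2 * ν - h - k) := by
      rw [this]
      positivity
    linarith
  have main : (2 * ν - 1 - 4 * z) * (h - k) ≤ (μ - ν) * (1 + k) * (1 - h) := by
    have hrhs : 0 ≤ (μ - ν) * (1 + k) * (1 - h) :=
      mul_nonneg (mul_nonneg (by linarith) (by linarith)) (by linarith)
    have hle : 2 * ν - 1 - 4 * z ≤ (1 - h) * (2 * ν - 1 - h) := by nlinarith
    rcases le_total (2 * ν - 1 - h) 0 with hc | hc
    · have : (2 * ν - 1 - 4 * z) * (h - k) ≤ 0 :=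
        mul_nonpos_of_nonpos_of_nonneg
          (hle.trans (mul_nonpos_of_nonneg_of_nonpos (by linarith) hc)) he
      linarith
    · calc (2 * ν - 1 - 4 * z) * (h - k)
          ≤ (1 - h) * (2 * ν - 1 - h) * (h - k) := by gcongr
        _ ≤ (1 - h) * ((h - k) * (2 * ν - h - k)) := by
          rw [mul_assoc, mul_comm (2 * ν - 1 - h)]
          have : 0 ≤ 1 - h := by linarith
          gcongr
          linarith
        _ ≤ (1 - h) * ((μ - ν) * (1 + k)) := by
          refine mul_le_mul_of_nonneg_left (hw.trans ?_) (by linarith)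
          nlinarith
        _ = _ := by ring
  have hform (κ A B h : ℝ) (hA : 0 < A) (hh : h = 2 * z * B / A) (h1 : h < 1) :
      κ + 2 * z * (-2 * A + (2 * κ - 1) * B) / (A - 2 * z * B) =
        1 - κ + (2 * κ - 1 - 4 * z) / (1 - h) := by
    have hB : 2 * z * B = h * A := by rw [hh]; field_simp
    have h1' : 1 - h ≠ 0 := by linarith
    rw [show 2 * z * (-2 * A + (2 * κ - 1) * B) = -4 * z * A + (2 * κ - 1) * (2 * z * B) by ring,
      hB, show A - h * A = A * (1 - h) by ring]
    field_simp
    ring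
  rw [hform ν A B h hA hh hh1, hform μ P Q k hP hk hk1, ← sub_nonneg]
  have h1 : 0 < 1 - h := by linarith
  have h2 : 0 < 1 - k := by linarith
  have hdiff : 1 - μ + (2 * μ - 1 - 4 * z) / (1 - k) - (1 - ν + (2 * ν - 1 - 4 * z) / (1 - h)) =
      ((μ - ν) * (1 + k) * (1 - h) - (2 * ν - 1 - 4 * z) * (h - k)) / ((1 - k) * (1 - h)) := by
    field_simp
    ring
  rw [hdiff]
  exact div_nonneg (by linarith) (by positivity)

lemma diniClifford_pos {t a : ℝ} (ht : -1 < t)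
    (hmin : ∀ y : ℝ, 0 < y → dini t y = 0 → a ≤ y) :
    ∀ x ∈ Ioo 0 a, 0 < diniClifford t (x ^ 2 / 4) := by
  intro x hx
  by_contra! hcon
  have h0 : 0 < diniClifford t ((0 : ℝ) ^ 2 / 4) := by
    simpa [diniClifford] using besselClifford_zero_pos ht
  have hcont : Continuous fun y : ℝ => diniClifford t (y ^ 2 / 4) :=
    (continuous_diniClifford ht).comp (by fun_prop)
  obtain ⟨y, hy, hy0⟩ := intermediate_value_Icc' hx.1.le hcont.continuousOn ⟨hcon, h0.le⟩
  have hypos : 0 < y := by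
    refine hy.1.lt_of_ne fun h => ?_
    subst h
    exact h0.ne' hy0
  have := hmin y hypos (by rw [dini_eq t hypos]; simp only at hy0; rw [hy0, mul_zero])
  linarith [hy.2, hx.2]

lemma diniClifford_pos_of_mem_Ioo {t a : ℝ} (ht : -1 < t) (ha : 0 < a)
    (hmin : ∀ y : ℝ, 0 < y → dini t y = 0 → a ≤ y) :
    ∀ z ∈ Ioo 0 (a ^ 2 / 4), 0 < diniClifford t z := by
  intro z hz
  have hs := Real.sq_sqrt hz.1.le
  have := diniClifford_pos ht hmin (2 * √z) ⟨by have := Real.sqrt_pos.2 hz.1; positivity, by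
    refine lt_of_pow_lt_pow_left₀ 2 ha.le ?_
    rw [mul_pow, hs]
    linarith [hz.2]⟩
  rwa [mul_pow, hs, show (2 : ℝ) ^ 2 * z / 4 = z by ring] at this

/-- The first positive zero of the Dini function is increasing in the order. -/
lemma dini_first_zero_le {ν μ a b : ℝ} (hν : -1 < ν) (hμ : ν ≤ μ) (ha : 0 < a) (hb : 0 < b)
    (hmina : ∀ y : ℝ, 0 < y → dini ν y = 0 → a ≤ y) (hb0 : dini μ b = 0)
    (hminb : ∀ y : ℝ, 0 < y → dini μ y = 0 → b ≤ y) : a ≤ b := by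
  by_contra! hlt
  have hμ' : -1 < μ := by linarith
  have hDν := diniClifford_pos_of_mem_Ioo hν ha hmina
  have hDμ := diniClifford_pos_of_mem_Ioo hμ' hb hminb
  have hlt2 : b ^ 2 / 4 < a ^ 2 / 4 := by gcongr
  have hz : b ^ 2 / 4 ∈ Ioc 0 (b ^ 2 / 4) := ⟨by positivity, le_rfl⟩
  have hE := besselClifford_cross_nonneg hν hμ
    (fun z hz => hDν z ⟨hz.1, hz.2.trans hlt2⟩) hDμ hz
  have hP := besselClifford_pos hμ' hDμ hz
  have hD := hDν _ ⟨hz.1, hlt2⟩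
  rw [dini_eq μ hb] at hb0
  have h0 := (mul_eq_zero.1 hb0).resolve_left (Real.rpow_pos_of_pos (by positivity) μ).ne'
  rw [diniClifford] at hD h0
  have h1 := mul_pos hP hD
  have h2 := mul_nonneg (mul_nonneg two_pos.le hz.1.le) hE
  have h3 := congrArg (besselClifford ν (b ^ 2 / 4) * ·) h0
  simp only [mul_zero] at h3
  linarith

/-- Let `μ ≥ ν > -1`, let `a1 t` denote the first positive zero of `d_t`
for every order `t > -1`, and let `x ∈ (0, a1 ν)`.  Then
`x d_μ'(x)/d_μ(x) ≥ x d_ν'(x)/d_ν(x)`; equivalently, `d_μ'(x)/d_μ(x) ≥ d_ν'(x)/d_ν(x)`.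
More precisely, for fixed `x` the function `t ↦ x d_t'(x)/d_t(x)` is increasing on the
set of orders `t ∈ (-1, ∞)` with `x < a1 t`. -/
theorem dini_log_deriv_increasing_in_order (μ ν : ℝ) (hν : -1 < ν) (hμν : ν ≤ μ)
    (a1 : ℝ → ℝ)
    (ha1 : ∀ t : ℝ, -1 < t →
      0 < a1 t ∧ dini t (a1 t) = 0 ∧ ∀ y : ℝ, 0 < y → dini t y = 0 → a1 t ≤ y)
    (x : ℝ) (hx : x ∈ Set.Ioo (0 : ℝ) (a1 ν)) :
    x * deriv (dini μ) x / dini μ x ≥ x * deriv (dini ν) x / dini ν x ∧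
    deriv (dini μ) x / dini μ x ≥ deriv (dini ν) x / dini ν x ∧
    MonotoneOn (fun t : ℝ => x * deriv (dini t) x / dini t x)
      {t : ℝ | -1 < t ∧ x < a1 t} := by
  have main : ∀ s t : ℝ, -1 < s → s ≤ t → x < a1 s →
      x * deriv (dini s) x / dini s x ≤ x * deriv (dini t) x / dini t x := by
    intro s t hs hst hxs
    have ht : -1 < t := by linarith
    obtain ⟨hs0, -, hsmin⟩ := ha1 s hs
    obtain ⟨ht0, htz, htmin⟩ := ha1 t ht
    have hle := dini_first_zero_le hs hst hs0 ht0 hsmin htz htmin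
    have hx0 := hx.1
    have hDs := diniClifford_pos_of_mem_Ioo hs hs0 hsmin
    have hDt := diniClifford_pos_of_mem_Ioo ht ht0 htmin
    have hz : x ^ 2 / 4 ∈ Ioo 0 (a1 s ^ 2 / 4) := ⟨by positivity, by gcongr⟩
    have hle2 : a1 s ^ 2 / 4 ≤ a1 t ^ 2 / 4 := by gcongr
    rw [dini_logDeriv hs hx0 (hDs _ hz).ne',
      dini_logDeriv ht hx0 (hDt _ ⟨hz.1, hz.2.trans_le hle2⟩).ne']
    exact diniClifford_logDeriv_le hs hst hDs
      (fun z hz => hDt z ⟨hz.1, hz.2.trans_le hle2⟩) hz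
  have h1 := main ν μ hν hμν hx.2
  refine ⟨h1, ?_, fun s hs t _ hst => main s t hs.1 hst hs.2⟩
  rw [mul_div_assoc, mul_div_assoc] at h1
  exact le_of_mul_le_mul_left h1 hx.1
end
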